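/- Fix the literal x = x_1 and, for each n ≥ 1, let f be the literal function (x_1,…,x_n) ↦ x_1 and 𝒳 the family of simple x trees on n variables. Then P_n(f) ∼ μ_n(𝒳) as n → ∞, and consequently P_n(f) ∼ P_n(True)/n². -/

import Mathlib

/-- An and/or tree skeleton: leaves carry a variable index and a polarity
(`true` = positive literal, `false` = negated literal); internal nodes carry
a connective (`true` = AND, `false` = OR) and a list of children. -/
inductive AT (n : ℕ) : Type
  | leaf : Fin n → Bool → AT n
  | node : Bool → List (AT n) → AT n

namespace AT

/-- The connective at the root, if the root is an internal node. -/
def rootConn {n : ℕ} : AT n → Option Bool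
  | .leaf _ _ => none
  | .node c _ => some c

/-- Whether a tree is a single leaf. -/
def isLeafB {n : ℕ} : AT n → Bool
  | .leaf _ _ => true
  | .node _ _ => false

/-- The children of the root. -/
def rootChildren {n : ℕ} : AT n → List (AT n)
  | .leaf _ _ => []
  | .node _ ts => ts

/-- Well-formedness: an associative tree is a plane tree in which each internal
node has at least two children, no internal node has the same connective as its
parent (stratification), and leaves carry literals. -/
inductive WF {n : ℕ} : AT n → Prop
  | leaf (i : Fin n) (b : Bool) : WF (.leaf i b)
  | node (c : Bool) (ts : List (AT n)) :
      2 ≤ ts.length → (∀ t ∈ ts, WF t) → (∀ t ∈ ts, rootConn t ≠ some c) →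
      WF (.node c ts)

mutual
/-- The size of a tree: its total number of nodes. -/
def size {n : ℕ} : AT n → ℕ
  | .leaf _ _ => 1
  | .node _ ts => 1 + sizeList ts
def sizeList {n : ℕ} : List (AT n) → ℕ
  | [] => 0
  | t :: ts => size t + sizeList ts
end

mutual
/-- The Boolean function computed by a tree. -/
def eval {n : ℕ} : AT n → (Fin n → Bool) → Bool
  | .leaf i b, x => if b then x i else ! x i
  | .node c ts, x => evalList c ts x
def evalList {n : ℕ} : Bool → List (AT n) → (Fin n → Bool) → Bool
  | c, [], _ => c
  | c, t :: ts, x => if c then eval t x && evalList c ts x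
                     else eval t x || evalList c ts x
end

end AT

open AT

/-- Number of associative trees of size `m` in a family `𝒯`. -/
noncomputable def countIn (n : ℕ) (𝒯 : Set (AT n)) (m : ℕ) : ℕ :=
  Nat.card {t : AT n // t ∈ 𝒯 ∧ WF t ∧ size t = m}

/-- `A n m` is the number of associative trees of size `m` on `n` variables. -/
noncomputable def A (n m : ℕ) : ℕ := countIn n Set.univ m

/-- `Pmn n m f` is the proportion, among associative trees of size `m` on `n`
variables, of those computing the Boolean function `f`. -/
noncomputable def Pmn (n m : ℕ) (f : (Fin n → Bool) → Bool) : ℝ :=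
  (countIn n {t | eval t = f} m : ℝ) / (A n m : ℝ)

/-- Ratio of trees of size `m` in the family `𝒯` among all trees of size `m`. -/
noncomputable def ratio (n : ℕ) (𝒯 : Set (AT n)) (m : ℕ) : ℝ :=
  (countIn n 𝒯 m : ℝ) / (A n m : ℝ)

/-- `HasLimRatio n 𝒯 μ` : the limiting ratio of the family `𝒯` exists and is `μ`. -/
def HasLimRatio (n : ℕ) (𝒯 : Set (AT n)) (μ : ℝ) : Prop :=
  Filter.Tendsto (ratio n 𝒯) Filter.atTop (nhds μ)

/-- Extension of a Boolean function of `n₀` variables to `n ≥ n₀` variables. -/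
def extend {n₀ n : ℕ} (h : n₀ ≤ n) (f : (Fin n₀ → Bool) → Bool) :
    (Fin n → Bool) → Bool :=
  fun x => f (fun j => x (Fin.castLE h j))

open Classical in
/-- The tree size complexity of a Boolean function. -/
noncomputable def Lcomp (n : ℕ) (f : (Fin n → Bool) → Bool) : ℕ :=
  if f = (fun _ => true) ∨ f = (fun _ => false) then 0
  else if ∃ i : Fin n, f = (fun x => x i) ∨ f = (fun x => ! x i) then 2
  else sInf {m | ∃ t : AT n, WF t ∧ size t = m ∧ eval t = f}

/-- The family `𝒳` of simple `x` trees for a literal `x` (here a positive literal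
given by a variable index): trees whose root has exactly two children and is either
labelled `∨`, with one child the leaf `x` and the other a non-leaf subtree
computing the constant function `False`, or labelled `∧`, with one child the leaf
`x` and the other a non-leaf subtree computing the constant function `True`. -/
def SimpleX (n : ℕ) (x : Fin n) : Set (AT n) :=
  {t | ∃ s : AT n, isLeafB s = false ∧
    ((eval s = (fun _ => false) ∧
        (t = AT.node false [AT.leaf x true, s] ∨ t = AT.node false [s, AT.leaf x true])) ∨
      (eval s = (fun _ => true) ∧
        (t = AT.node true [AT.leaf x true, s] ∨ t = AT.node true [s, AT.leaf x true])))}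

namespace S17
open PowerSeries Filter Topology

/-- `Lo f r`: the lower limit of `f` is at least `r`. -/
def Lo (f : ℕ → ℝ) (r : ℝ) : Prop :=
  ∃ φ : ℕ → ℝ, Tendsto φ atTop (𝓝 r) ∧ ∀ᶠ m in atTop, φ m ≤ f m

lemma lo_iff {f : ℕ → ℝ} {r : ℝ} : Lo f r ↔ ∀ s < r, ∀ᶠ m in atTop, s ≤ f m := by
  constructor
  · rintro ⟨φ, h1, h2⟩ s hs
    filter_upwards [h1.eventually (lt_mem_nhds hs), h2] with m a b
    linarith
  · intro h
    refine ⟨fun m => min (f m) r, ?_, Eventually.of_forall fun m => min_le_left _ _⟩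
    rw [tendsto_order]
    refine ⟨fun s hs => ?_, fun s hs => Eventually.of_forall fun m => (min_le_right _ _).trans_lt hs⟩
    obtain ⟨t, h1, h2⟩ := exists_between hs
    filter_upwards [h t h2] with m hm
    exact lt_min (h1.trans_le hm) hs

lemma Lo.of_tendsto {f : ℕ → ℝ} {r : ℝ} (h : Tendsto f atTop (𝓝 r)) : Lo f r :=
  ⟨f, h, Eventually.of_forall fun _ => le_rfl⟩

lemma Lo.add {f g : ℕ → ℝ} {r s : ℝ} (h : Lo f r) (h' : Lo g s) :
    Lo (fun m => f m + g m) (r + s) := by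
  obtain ⟨φ, a, b⟩ := h
  obtain ⟨ψ, c, d⟩ := h'
  refine ⟨_, a.add c, ?_⟩
  filter_upwards [b, d] with m hb hd
  exact add_le_add hb hd

lemma Lo.mul_tendsto {f g : ℕ → ℝ} {r s : ℝ} (h : Lo f r) (h' : Tendsto g atTop (𝓝 s))
    (hg : ∀ᶠ m in atTop, 0 ≤ g m) : Lo (fun m => f m * g m) (r * s) := by
  obtain ⟨φ, a, b⟩ := h
  refine ⟨_, a.mul h', ?_⟩
  filter_upwards [b, hg] with m hb hd
  exact mul_le_mul_of_nonneg_right hb hd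

lemma Lo.mono {f g : ℕ → ℝ} {r : ℝ} (h : Lo f r) (h' : ∀ᶠ m in atTop, f m ≤ g m) : Lo g r := by
  obtain ⟨φ, a, b⟩ := h
  refine ⟨_, a, ?_⟩
  filter_upwards [b, h'] with m hb hd
  exact hb.trans hd

lemma Lo.weaken {f : ℕ → ℝ} {r s : ℝ} (h : Lo f r) (h' : s ≤ r) : Lo f s := by
  rw [lo_iff] at h ⊢
  exact fun t ht => h t (ht.trans_le h')

lemma Lo.sum {ι : Type*} (s : Finset ι) {f : ι → ℕ → ℝ} {r : ι → ℝ} (h : ∀ i ∈ s, Lo (f i) (r i)) :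
    Lo (fun m => ∑ i ∈ s, f i m) (∑ i ∈ s, r i) := by
  classical
  induction s using Finset.induction_on with
  | empty => simpa using Lo.of_tendsto tendsto_const_nhds
  | insert a s ha ih =>
    simp only [Finset.sum_insert ha]
    exact (h a (by simp)).add (ih fun i hi => h i (by simp [hi]))

lemma Lo.comp {f : ℕ → ℝ} {r : ℝ} (h : Lo f r) {k : ℕ → ℕ} (hk : Tendsto k atTop atTop) :
    Lo (fun m => f (k m)) r := by
  obtain ⟨φ, a, b⟩ := h
  exact ⟨_, a.comp hk, hk.eventually b⟩

lemma Lo.of_lim {f : ℕ → ℝ} {r : ℕ → ℝ} {s : ℝ} (h : ∀ k, Lo f (r k))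
    (hr : Tendsto r atTop (𝓝 s)) : Lo f s := by
  rw [lo_iff]
  intro t ht
  obtain ⟨k, hk⟩ := (hr.eventually (lt_mem_nhds ht)).exists
  exact (lo_iff.1 (h k)) t hk

lemma Lo.le_of_tendsto {f : ℕ → ℝ} {r s : ℝ} (h : Lo f r) (h' : Tendsto f atTop (𝓝 s)) : r ≤ s := by
  obtain ⟨φ, a, b⟩ := h
  exact le_of_tendsto_of_tendsto a h' b

/-- Lower limits adding up to the limit of the sum are limits. -/
lemma tendsto_of_lo_sum {ι : Type*} [Fintype ι] {f : ι → ℕ → ℝ} {r : ι → ℝ} {R : ℝ}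
    (h : ∀ i, Lo (f i) (r i)) (ht : Tendsto (fun m => ∑ i, f i m) atTop (𝓝 R))
    (hR : R ≤ ∑ i, r i) (j : ι) : Tendsto (f j) atTop (𝓝 (r j)) := by
  classical
  have h1 : Lo (fun m => ∑ i ∈ Finset.univ.erase j, f i m) (∑ i ∈ Finset.univ.erase j, r i) :=
    Lo.sum _ fun i _ => h i
  have e1 : ∀ m, f j m = ∑ i, f i m - ∑ i ∈ Finset.univ.erase j, f i m := by
    intro m
    rw [← Finset.add_sum_erase _ _ (Finset.mem_univ j)]; ring
  have e2 : r j = ∑ i, r i - ∑ i ∈ Finset.univ.erase j, r i := by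
    rw [← Finset.add_sum_erase _ _ (Finset.mem_univ j)]; ring
  obtain ⟨φ, a, b⟩ := h1
  obtain ⟨ψ, c, d⟩ := h j
  rw [tendsto_order]
  constructor
  · intro s hs
    filter_upwards [c.eventually (lt_mem_nhds hs), d] with m x y
    linarith
  · intro s hs
    have : R - ∑ i ∈ Finset.univ.erase j, r i < s := by linarith
    filter_upwards [(ht.sub a).eventually (gt_mem_nhds this), b] with m x y
    rw [e1]
    linarith

/-- Coefficientwise order on power series. -/
def Le (u v : ℝ⟦X⟧) : Prop := ∀ m, coeff m u ≤ coeff m v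

/-- Nonnegative coefficients. -/
def Nn (u : ℝ⟦X⟧) : Prop := ∀ m, 0 ≤ coeff m u

lemma Nn.mul {u v : ℝ⟦X⟧} (hu : Nn u) (hv : Nn v) : Nn (u * v) := fun m => by
  rw [coeff_mul]
  exact Finset.sum_nonneg fun p _ => mul_nonneg (hu _) (hv _)

lemma Nn.add {u v : ℝ⟦X⟧} (hu : Nn u) (hv : Nn v) : Nn (u + v) := fun m => by
  rw [map_add]
  exact add_nonneg (hu _) (hv _)

lemma nn_one : Nn 1 := fun m => by rw [coeff_one]; split_ifs <;> norm_num

lemma nn_X : Nn X := fun m => by rw [coeff_X]; split_ifs <;> norm_num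

lemma nn_C {c : ℝ} (hc : 0 ≤ c) : Nn (C c) := fun m => by
  rw [coeff_C]; split_ifs <;> first | exact hc | exact le_rfl

lemma Nn.sum {ι : Type*} (s : Finset ι) {u : ι → ℝ⟦X⟧} (h : ∀ i ∈ s, Nn (u i)) :
    Nn (∑ i ∈ s, u i) := fun m => by
  rw [map_sum]; exact Finset.sum_nonneg fun i hi => h i hi m

/-- The value of a power series. -/
def Val (ρ : ℝ) (u : ℝ⟦X⟧) (U : ℝ) : Prop := HasSum (fun m => coeff m u * ρ ^ m) U

lemma Val.add {ρ U V : ℝ} {u v : ℝ⟦X⟧} (hu : Val ρ u U) (hv : Val ρ v V) : Val ρ (u + v) (U + V) := by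
  unfold Val
  simpa [add_mul] using HasSum.add hu hv

lemma Val.mul {ρ U V : ℝ} {u v : ℝ⟦X⟧} (hρ : 0 ≤ ρ) (nu : Nn u) (nv : Nn v)
    (hu : Val ρ u U) (hv : Val ρ v V) : Val ρ (u * v) (U * V) := by
  unfold Val at *
  have su : Summable fun m => ‖coeff m u * ρ ^ m‖ := by
    simpa [abs_of_nonneg (nu _), abs_of_nonneg hρ] using hu.summable
  have sv : Summable fun m => ‖coeff m v * ρ ^ m‖ := by
    simpa [abs_of_nonneg (nv _), abs_of_nonneg hρ] using hv.summable
  have key : (fun m => coeff m (u * v) * ρ ^ m) = fun m => ∑ p ∈ Finset.HasAntidiagonal.antidiagonal m,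
      (coeff p.1 u * ρ ^ p.1) * (coeff p.2 v * ρ ^ p.2) := by
    funext m
    rw [coeff_mul, Finset.sum_mul]
    refine Finset.sum_congr rfl fun p hp => ?_
    rw [← Finset.HasAntidiagonal.mem_antidiagonal.1 hp, pow_add]; ring
  rw [key]
  have s := (summable_norm_sum_mul_antidiagonal_of_summable_norm su sv).of_norm
  have := tsum_mul_tsum_eq_tsum_sum_antidiagonal_of_summable_norm su sv
  rw [hu.tsum_eq, hv.tsum_eq] at this
  rw [this]
  exact s.hasSum

lemma val_C (ρ c : ℝ) : Val ρ (C c) c := by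
  unfold Val
  convert hasSum_ite_eq 0 c using 2 with m
  rw [coeff_C]; split_ifs with h <;> simp [h]

lemma val_X (ρ : ℝ) : Val ρ X ρ := by
  unfold Val
  convert hasSum_ite_eq 1 ρ using 2 with m
  rw [coeff_X]; split_ifs with h <;> simp [h]

/-- The analytic context: a reference series `g` at its critical point `ρ`. -/
structure Ctx (g : ℝ⟦X⟧) (ρ W : ℝ) : Prop where
  pos : ∀ m, 0 < coeff m g
  rpos : 0 < ρ
  ratio : Tendsto (fun m => coeff m g / coeff (m + 1) g) atTop (𝓝 ρ)
  val : Val ρ g W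
  sq : Tendsto (fun m => coeff m (g * g) / coeff m g) atTop (𝓝 (2 * W))

/-- Regular series: nonnegative coefficients, value `U` at `ρ`, limiting ratio `r`. -/
structure Reg (g : ℝ⟦X⟧) (ρ : ℝ) (u : ℝ⟦X⟧) (U r : ℝ) : Prop where
  nn : Nn u
  val : Val ρ u U
  lim : Tendsto (fun m => coeff m u / coeff m g) atTop (𝓝 r)

section
variable {g u v : ℝ⟦X⟧} {ρ W U V r s : ℝ}

lemma Ctx.ratio_pow (h : Ctx g ρ W) (j : ℕ) :
    Tendsto (fun m => coeff m g / coeff (m + j) g) atTop (𝓝 (ρ ^ j)) := by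
  induction j with
  | zero =>
    simp only [add_zero, pow_zero]
    refine tendsto_const_nhds.congr fun m => (div_self (h.pos m).ne').symm
  | succ j ih =>
    have := ih.mul (h.ratio.comp (tendsto_add_atTop_nat j))
    rw [pow_succ]
    refine this.congr fun m => ?_
    have := (h.pos (m + j)).ne'
    simp only [Function.comp]
    rw [← add_assoc]
    field_simp

lemma Ctx.ratio_sub (h : Ctx g ρ W) (j : ℕ) :
    Tendsto (fun m => coeff (m - j) g / coeff m g) atTop (𝓝 (ρ ^ j)) := by
  refine ((h.ratio_pow j).comp (tendsto_sub_atTop_nat j)).congr' ?_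
  filter_upwards [eventually_ge_atTop j] with m hm
  simp [Nat.sub_add_cancel hm]

lemma lo_shift (h : Ctx g ρ W) (hr : Lo (fun m => coeff m u / coeff m g) r) (j : ℕ) :
    Lo (fun m => coeff (m - j) u / coeff m g) (r * ρ ^ j) := by
  refine ((hr.comp (tendsto_sub_atTop_nat j)).mul_tendsto (h.ratio_sub j)
    (Eventually.of_forall fun m => (div_pos (h.pos _) (h.pos _)).le)).mono
    (Eventually.of_forall fun m => le_of_eq ?_)
  have := (h.pos (m - j)).ne'
  field_simp

lemma coeff_mul_ge (nu : Nn u) (nv : Nn v) (J m : ℕ) (hm : 2 * J ≤ m) :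
    ∑ j ∈ Finset.range J, coeff j u * coeff (m - j) v +
      ∑ j ∈ Finset.range J, coeff j v * coeff (m - j) u ≤ coeff m (u * v) := by
  rw [coeff_mul, Finset.Nat.sum_antidiagonal_eq_sum_range_succ (fun i j => coeff i u * coeff j v)]
  have e : ∑ j ∈ Finset.range J, coeff j v * coeff (m - j) u =
      ∑ i ∈ (Finset.range J).image (fun j => m - j), coeff i u * coeff (m - i) v := by
    rw [Finset.sum_image]
    · refine Finset.sum_congr rfl fun j hj => ?_
      have := Finset.mem_range.1 hj
      rw [show m - (m - j) = j by omega]; ring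
    · intro a ha b hb hab
      have := Finset.mem_range.1 (Finset.mem_coe.1 ha)
      have := Finset.mem_range.1 (Finset.mem_coe.1 hb)
      simp only at hab
      omega
  rw [e, ← Finset.sum_union]
  · refine Finset.sum_le_sum_of_subset_of_nonneg ?_ fun i _ _ => mul_nonneg (nu _) (nv _)
    intro i hi
    simp only [Finset.mem_union, Finset.mem_range, Finset.mem_image] at hi ⊢
    rcases hi with h | ⟨j, h, rfl⟩ <;> omega
  · rw [Finset.disjoint_left]
    intro i hi hi'
    simp only [Finset.mem_range, Finset.mem_image] at hi hi'
    obtain ⟨j, h, rfl⟩ := hi'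
    omega

/-- Fatou's lemma for products. -/
lemma lo_mul (h : Ctx g ρ W) (nu : Nn u) (nv : Nn v) (hU : Val ρ u U) (hV : Val ρ v V)
    (lu : Lo (fun m => coeff m u / coeff m g) r) (lv : Lo (fun m => coeff m v / coeff m g) s) :
    Lo (fun m => coeff m (u * v) / coeff m g) (U * s + V * r) := by
  refine Lo.of_lim (r := fun J => (∑ j ∈ Finset.range J, coeff j u * ρ ^ j) * s +
    (∑ j ∈ Finset.range J, coeff j v * ρ ^ j) * r) ?_
    ((hU.tendsto_sum_nat.mul_const s).add (hV.tendsto_sum_nat.mul_const r))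
  intro J
  have a : ∀ (u v : ℝ⟦X⟧) (s : ℝ), Nn u → Lo (fun m => coeff m v / coeff m g) s →
      Lo (fun m => ∑ j ∈ Finset.range J, coeff (m - j) v / coeff m g * coeff j u)
        (∑ j ∈ Finset.range J, s * ρ ^ j * coeff j u) := fun u v s nu lv =>
    Lo.sum _ fun j _ => (lo_shift h lv j).mul_tendsto tendsto_const_nhds
      (Eventually.of_forall fun _ => nu j)
  have b := (a u v s nu lv).add (a v u r nv lu)
  have e : (∑ j ∈ Finset.range J, coeff j u * ρ ^ j) * s +
    (∑ j ∈ Finset.range J, coeff j v * ρ ^ j) * r = ∑ j ∈ Finset.range J, s * ρ ^ j * coeff j u +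
     ∑ j ∈ Finset.range J, r * ρ ^ j * coeff j v := by
    rw [Finset.sum_mul, Finset.sum_mul]
    congr 1 <;> exact Finset.sum_congr rfl fun _ _ => by ring
  rw [e]
  refine b.mono ?_
  filter_upwards [eventually_ge_atTop (2 * J)] with m hm
  rw [le_div_iff₀ (h.pos m)]
  refine le_trans (le_of_eq ?_) (coeff_mul_ge nu nv J m hm)
  have := (h.pos m).ne'
  rw [add_mul, Finset.sum_mul, Finset.sum_mul]
  congr 1 <;> exact Finset.sum_congr rfl fun _ _ => by field_simp

lemma Reg.lo (h : Reg g ρ u U r) : Lo (fun m => coeff m u / coeff m g) r := Lo.of_tendsto h.lim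

lemma Reg.unique (h : Reg g ρ u U r) (h' : Reg g ρ u V s) : U = V ∧ r = s :=
  ⟨h.val.unique h'.val, tendsto_nhds_unique h.lim h'.lim⟩

lemma Reg.le (c : Ctx g ρ W) (h : Reg g ρ u U r) (h' : Reg g ρ v V s) (hl : Le u v) :
    U ≤ V ∧ r ≤ s :=
  ⟨hasSum_le (fun m => mul_le_mul_of_nonneg_right (hl m) (pow_nonneg c.rpos.le m)) h.val h'.val,
    le_of_tendsto_of_tendsto' h.lim h'.lim fun m => div_le_div_of_nonneg_right (hl m) (c.pos m).le⟩

lemma Reg.nonneg (c : Ctx g ρ W) (h : Reg g ρ u U r) : 0 ≤ U ∧ 0 ≤ r :=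
  ⟨h.val.nonneg fun m => mul_nonneg (h.nn m) (pow_nonneg c.rpos.le m),
    ge_of_tendsto' h.lim fun m => div_nonneg (h.nn m) (c.pos m).le⟩

lemma Reg.add (h : Reg g ρ u U r) (h' : Reg g ρ v V s) : Reg g ρ (u + v) (U + V) (r + s) :=
  ⟨h.nn.add h'.nn, h.val.add h'.val, by simpa [add_div] using h.lim.add h'.lim⟩

lemma Reg.sub (h : Reg g ρ (u + v) U r) (h' : Reg g ρ v V s) (nu : Nn u) :
    Reg g ρ u (U - V) (r - s) :=
  ⟨nu, by simpa [Val, add_mul] using HasSum.sub h.val h'.val,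
    by simpa [add_div] using h.lim.sub h'.lim⟩

lemma Reg.bound (c : Ctx g ρ W) (h : Reg g ρ u U r) :
    ∃ K, 0 ≤ K ∧ ∀ m, coeff m u ≤ K * coeff m g := by
  obtain ⟨K, hK⟩ := h.lim.bddAbove_range
  refine ⟨K, ?_, fun m => ?_⟩
  · exact (div_nonneg (h.nn 0) (c.pos 0).le).trans (hK ⟨0, rfl⟩)
  · rw [← div_le_iff₀ (c.pos m)]
    exact hK ⟨m, rfl⟩

lemma Ctx.reg (c : Ctx g ρ W) : Reg g ρ g W 1 :=
  ⟨fun m => (c.pos m).le, c.val, tendsto_const_nhds.congr fun m => (div_self (c.pos m).ne').symm⟩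

lemma reg_C (c : Ctx g ρ W) {k : ℝ} (hk : 0 ≤ k) : Reg g ρ (C k) k 0 := by
  refine ⟨nn_C hk, val_C _ _, ?_⟩
  refine tendsto_const_nhds.congr' ?_
  filter_upwards [eventually_ge_atTop 1] with m hm
  rw [coeff_C, if_neg (by omega), zero_div]

lemma reg_X (c : Ctx g ρ W) : Reg g ρ X ρ 0 := by
  refine ⟨nn_X, val_X _, ?_⟩
  refine tendsto_const_nhds.congr' ?_
  filter_upwards [eventually_ge_atTop 2] with m hm
  rw [coeff_X, if_neg (by omega), zero_div]

lemma reg_one (c : Ctx g ρ W) : Reg g ρ 1 1 0 := by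
  simpa using reg_C c zero_le_one

lemma Reg.congr {U' r' : ℝ} (h : Reg g ρ u U r) (hU : U = U') (hr : r = r') : Reg g ρ u U' r' := by
  subst hU hr; exact h

lemma Reg.mul (c : Ctx g ρ W) (h : Reg g ρ u U r) (h' : Reg g ρ v V s) :
    Reg g ρ (u * v) (U * V) (U * s + V * r) := by
  refine ⟨h.nn.mul h'.nn, h.val.mul c.rpos.le h.nn h'.nn h'.val, ?_⟩
  obtain ⟨K, K0, hK⟩ := h.bound c
  obtain ⟨L, L0, hL⟩ := h'.bound c
  have hc : ∀ (M : ℝ), Val ρ (C M * g) (M * W) := fun M => by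
    simpa [Val, mul_assoc] using HasSum.mul_left M c.val
  have lc : ∀ M : ℝ, Tendsto (fun m => coeff m (C M * g) / coeff m g) atTop (𝓝 M) := fun M =>
    tendsto_const_nhds.congr fun m => by
      rw [coeff_C_mul, mul_div_assoc, div_self (c.pos m).ne', mul_one]
  have key : ∀ (u : ℝ⟦X⟧) (U r K : ℝ), Reg g ρ u U r → (∀ m, coeff m u ≤ K * coeff m g) →
      Reg g ρ (C K * g - u) (K * W - U) (K - r) := fun u U r K h hK =>
    ⟨fun m => by rw [map_sub, coeff_C_mul]; linarith [hK m],
     by simpa [Val, sub_mul] using HasSum.sub (hc K) h.val,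
     by simpa [sub_div] using (lc K).sub h.lim⟩
  have hu := key u U r K h hK
  have hv := key v V s L h' hL
  have nCg : Nn (C L * g) := fun m => by
    rw [coeff_C_mul]; exact mul_nonneg L0 (c.pos m).le
  have l1 := lo_mul c h.nn h'.nn h.val h'.val h.lo h'.lo
  have l2 := lo_mul c h.nn hv.nn h.val hv.val h.lo hv.lo
  have l3 := lo_mul c hu.nn nCg hu.val (hc L) hu.lo (Lo.of_tendsto (lc L))
  have tot : Tendsto (fun m => coeff m (C K * g * (C L * g)) / coeff m g) atTop
      (𝓝 (K * L * (2 * W))) := by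
    refine (c.sq.const_mul (K * L)).congr fun m => ?_
    rw [show C K * g * (C L * g) = C (K * L) * (g * g) by rw [map_mul]; ring, coeff_C_mul]
    ring
  have l4 := l2.add l3
  refine (tendsto_of_lo_sum (ι := Bool) (f := fun b m => bif b then coeff m (u * v) / coeff m g
     else coeff m (u * (C L * g - v)) / coeff m g + coeff m ((C K * g - u) * (C L * g)) / coeff m g)
     (r := fun b => bif b then U * s + V * r else
       U * (L - s) + (L * W - V) * r + ((K * W - U) * L + L * W * (K - r)))
     (R := K * L * (2 * W)) ?_ ?_ ?_ true)
  · intro b; cases b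
    · exact l4
    · exact l1
  · refine tot.congr fun m => ?_
    simp only [Fintype.sum_bool, cond_true, cond_false]
    rw [← add_div, ← add_div, ← map_add, ← map_add]
    congr 2
    ring
  · simp only [Fintype.sum_bool, cond_true, cond_false]
    apply le_of_eq
    ring

lemma Reg.sum {ι : Type*} (c : Ctx g ρ W) (t : Finset ι) {u : ι → ℝ⟦X⟧} {U r : ι → ℝ}
    (h : ∀ i ∈ t, Reg g ρ (u i) (U i) (r i)) :
    Reg g ρ (∑ i ∈ t, u i) (∑ i ∈ t, U i) (∑ i ∈ t, r i) := by
  classical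
  induction t using Finset.induction_on with
  | empty => simpa using reg_C c le_rfl
  | insert a s ha ih =>
    simp only [Finset.sum_insert ha]
    exact (h a (by simp)).add (ih fun i hi => h i (by simp [hi]))

end
end S17

namespace S17
open PowerSeries Filter Topology

lemma contraction {e ε : ℕ → ℝ} {θ : ℝ} (h0 : 0 ≤ θ) (h1 : θ < 1) (he : ∀ k, 0 ≤ e k)
    (hr : ∀ k, e (k + 1) ≤ θ * e k + ε k) (hε : Tendsto ε atTop (𝓝 0)) :
    Tendsto e atTop (𝓝 0) := by
  rw [tendsto_order]
  refine ⟨fun a ha => Eventually.of_forall fun k => ha.trans_le (he k), fun η hη => ?_⟩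
  have hp : 0 < (1 - θ) * (η / 2) := mul_pos (by linarith) (by linarith)
  obtain ⟨N, hN⟩ := eventually_atTop.1 (hε.eventually (gt_mem_nhds hp))
  have key : ∀ j, e (N + j) ≤ θ ^ j * e N + η / 2 := by
    intro j
    induction j with
    | zero => simp; linarith
    | succ j ih =>
      have a := hr (N + j)
      have b := hN (N + j) (by omega)
      have c := mul_le_mul_of_nonneg_left ih h0
      rw [← add_assoc, pow_succ]
      nlinarith
  have lim : Tendsto (fun j => θ ^ j * e N + η / 2) atTop (𝓝 (0 * e N + η / 2)) :=
    ((tendsto_pow_atTop_nhds_zero_of_lt_one h0 h1).mul_const _).add_const _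
  obtain ⟨M, hM⟩ := eventually_atTop.1 (lim.eventually (gt_mem_nhds (by linarith : 0 * e N + η / 2 < η)))
  filter_upwards [eventually_ge_atTop (N + M)] with k hk
  have := key (k - N)
  rw [show N + (k - N) = k by omega] at this
  exact this.trans_lt (hM _ (by omega))

section
variable {H : ℝ⟦X⟧} {w : ℝ}

lemma rec_H (hH : H = C (w ^ 2) * X + C (w ^ 2) * X * H + X * (H * H)) (m : ℕ) :
    coeff (m + 1) H = (if m = 0 then w ^ 2 else 0) + w ^ 2 * coeff m H + coeff m (H * H) := by
  conv_lhs => rw [hH]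
  rw [map_add, map_add, mul_assoc, coeff_C_mul, coeff_C_mul, coeff_succ_X_mul, coeff_succ_X_mul,
    coeff_X]
  simp

lemma zero_H (hH : H = C (w ^ 2) * X + C (w ^ 2) * X * H + X * (H * H)) : coeff 0 H = 0 := by
  conv_lhs => rw [hH]
  simp

lemma deriv_quad (p s : ℝ) : derivative ℝ (1 - C p * X + C s * X ^ 2 : ℝ⟦X⟧) = - C p + C (2 * s) * X := by
  ext m
  rw [coeff_derivative]
  simp only [map_add, map_sub (coeff _), map_neg, coeff_C_mul, coeff_one, coeff_X, coeff_X_pow, coeff_C]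
  rcases m with _ | _ | m
  · simp
  · simp; ring
  · simp

lemma prec_H (hH : H = C (w ^ 2) * X + C (w ^ 2) * X * H + X * (H * H)) (k : ℕ) (hk : 1 ≤ k) :
    (k + 3) * coeff (k + 2) H = 2 * w ^ 2 * (k + 3 / 2) * coeff (k + 1) H
      - (w ^ 4 - 4 * w ^ 2) * k * coeff k H := by
  set D : ℝ⟦X⟧ := 1 - C (w ^ 2) * X - C 2 * (X * H) with hD
  set Q : ℝ⟦X⟧ := 1 - C (2 * w ^ 2) * X + C (w ^ 4 - 4 * w ^ 2) * X ^ 2 with hQ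
  have dd : D * D = Q := by
    have e2 : (C 2 : ℝ⟦X⟧) = 2 := map_ofNat C 2
    have e4' : (C 4 : ℝ⟦X⟧) = 4 := map_ofNat C 4
    have e4 : C (w ^ 4 - 4 * w ^ 2) = C (w ^ 2) * C (w ^ 2) - 4 * C (w ^ 2) := by
      rw [show w ^ 4 = w ^ 2 * w ^ 2 by ring, map_sub, map_mul, map_mul, e4']
    have e5 : C (2 * w ^ 2) = 2 * C (w ^ 2) := by rw [map_mul, e2]
    rw [hD, hQ, e2, e4, e5]
    linear_combination (-4 * X) * hH
  have dq : 2 * (Q * derivative ℝ D) = derivative ℝ Q * D := by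
    rw [← dd, Derivation.leibniz]
    simp only [smul_eq_mul]
    ring
  have qq : derivative ℝ Q = - C (2 * w ^ 2) + C (2 * (w ^ 4 - 4 * w ^ 2)) * X := deriv_quad _ _
  have dc : ∀ m, 1 ≤ m → coeff (m + 1) D = -2 * coeff m H := by
    intro m hm
    rw [hD, map_sub, map_sub, coeff_C_mul, coeff_C_mul, coeff_succ_X_mul, coeff_X, coeff_one,
      if_neg (by omega), if_neg (by omega)]
    ring
  have c := congrArg (coeff (k + 2)) dq
  have e1 : 2 * (Q * derivative ℝ D) = C 2 * derivative ℝ D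
     - C (4 * w ^ 2) * (X * derivative ℝ D) + C (2 * (w ^ 4 - 4 * w ^ 2)) * (X * (X * derivative ℝ D)) := by
    rw [hQ]
    rw [show C (4 * w ^ 2) = 2 * C (2 * w ^ 2) by rw [← map_ofNat (C : ℝ →+* ℝ⟦X⟧) 2, ← map_mul]; congr 1; ring,
      map_mul C 2 (w ^ 4 - 4 * w ^ 2), map_ofNat]
    ring
  rw [e1, qq, show (- C (2 * w ^ 2) + C (2 * (w ^ 4 - 4 * w ^ 2)) * X) * D =
    C (2 * (w ^ 4 - 4 * w ^ 2)) * (X * D) - C (2 * w ^ 2) * D by ring] at c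
  simp only [map_sub, map_add, coeff_C_mul, coeff_succ_X_mul, coeff_derivative] at c
  rw [show k + 2 + 1 = (k + 2) + 1 from rfl, dc (k + 2) (by omega), show k + 1 + 1 = (k + 1) + 1 from rfl,
    dc (k + 1) (by omega), dc k hk] at c
  push_cast at c
  linear_combination (-1/4) * c

/-- The context obtained from the quadratic equation. -/
theorem ctx_of_H (hw : 1 < w) (nH : Nn H)
    (hH : H = C (w ^ 2) * X + C (w ^ 2) * X * H + X * (H * H)) :
    Ctx (1 + H) (1 / (w * (w + 2))) (1 + w) := by
  have w2 : 0 < w ^ 2 := by positivity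
  have hge : ∀ m, w ^ 2 * coeff m H ≤ coeff (m + 1) H := by
    intro m
    rw [rec_H hH]
    have := (nH.mul nH) m
    split_ifs <;> linarith
  have hpos : ∀ m, 0 < coeff (m + 1) H := by
    intro m
    induction m with
    | zero =>
      rw [rec_H hH, zero_H hH, if_pos rfl]
      have := (nH.mul nH) 0
      linarith
    | succ m ih => exact (mul_pos w2 ih).trans_le (hge _)
  have h0 := zero_H hH
  set α := w * (w + 2) with hα
  have αpos : 0 < α := by positivity
  set x : ℕ → ℝ := fun k => coeff (k + 2) H / coeff (k + 1) H with hx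
  have xge : ∀ k, w ^ 2 ≤ x k := fun k => by
    rw [hx, le_div_iff₀ (hpos k)]; exact hge (k + 1)
  have xpos : ∀ k, 0 < x k := fun k => w2.trans_le (xge k)
  have xrec : ∀ k : ℕ, x (k + 1) = 2 * w ^ 2 * (k + 1 + 3 / 2) / (k + 4)
      - (w ^ 4 - 4 * w ^ 2) * (k + 1) / ((k + 4) * x k) := by
    intro k
    have p := prec_H hH (k + 1) (by omega)
    have a := (hpos k).ne'
    have b := (hpos (k + 1)).ne'
    have hk : (k : ℝ) + 4 ≠ 0 := by positivity
    push_cast at p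
    simp only [hx]
    field_simp
    linear_combination p
  have xlim : Tendsto x atTop (𝓝 α) := by
    rw [← tendsto_sub_nhds_zero_iff]
    apply (tendsto_zero_iff_abs_tendsto_zero _).2
    refine contraction (θ := |w ^ 2 - 2 * w| / w ^ 2)
      (ε := fun k => (3 * w ^ 2 + 3 * |w ^ 4 - 4 * w ^ 2| / w ^ 2) / (k + 4)) (by positivity) ?_
      (fun k => abs_nonneg _) ?_ ?_
    · rw [div_lt_one w2, abs_lt]
      constructor <;> nlinarith
    · intro k
      simp only [Function.comp]
      have hk : (0 : ℝ) < (k : ℝ) + 4 := by positivity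
      have hxk := xpos k
      have e : x (k + 1) - α = (w ^ 2 - 2 * w) * (x k - α) / x k
          + (-(3 * w ^ 2) + 3 * (w ^ 4 - 4 * w ^ 2) / x k) / (k + 4) := by
        rw [xrec, hα]
        field_simp
        ring
      rw [e]
      refine (abs_add_le _ _).trans (add_le_add ?_ ?_)
      · rw [abs_div, abs_mul, abs_of_pos hxk, div_mul_eq_mul_div]
        exact div_le_div_of_nonneg_left (by positivity) w2 (xge k)
      · rw [abs_div, abs_of_pos hk]
        refine div_le_div_of_nonneg_right ?_ hk.le
        refine (abs_add_le _ _).trans (add_le_add ?_ ?_)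
        · rw [abs_neg, abs_of_pos (by positivity)]
        · rw [abs_div, abs_of_pos hxk, abs_mul, abs_of_pos (by norm_num : (0 : ℝ) < 3)]
          exact div_le_div_of_nonneg_left (by positivity) w2 (xge k)
    · have := (tendsto_const_div_atTop_nhds_zero_nat
        (3 * w ^ 2 + 3 * |w ^ 4 - 4 * w ^ 2| / w ^ 2)).comp (tendsto_add_atTop_nat 4)
      refine this.congr fun k => ?_
      simp
  set g : ℝ⟦X⟧ := 1 + H with hg
  have gs : ∀ m, coeff (m + 1) g = coeff (m + 1) H := fun m => by
    rw [hg, map_add, coeff_one, if_neg (by omega), zero_add]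
  have g0 : coeff 0 g = 1 := by rw [hg, map_add, h0, coeff_one, if_pos rfl, add_zero]
  have gpos : ∀ m, 0 < coeff m g := by
    intro m
    rcases m with _ | m
    · rw [g0]; norm_num
    · rw [gs]; exact hpos m
  set ρ := 1 / α with hρ
  have ρpos : 0 < ρ := by positivity
  have grat : Tendsto (fun m => coeff (m + 1) g / coeff m g) atTop (𝓝 α) := by
    rw [← tendsto_add_atTop_iff_nat 1]
    refine xlim.congr fun k => ?_
    rw [gs, gs]
  have ratio : Tendsto (fun m => coeff m g / coeff (m + 1) g) atTop (𝓝 ρ) := by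
    rw [hρ, one_div]
    refine (grat.inv₀ αpos.ne').congr fun m => ?_
    rw [inv_div]
  -- summability
  have rp : ∀ j : ℕ, Tendsto (fun m => coeff (m - j) g / coeff m g) atTop (𝓝 (ρ ^ j)) := by
    intro j
    have : Tendsto (fun m => coeff m g / coeff (m + j) g) atTop (𝓝 (ρ ^ j)) := by
      induction j with
      | zero =>
        simp only [add_zero, pow_zero]
        refine tendsto_const_nhds.congr fun m => (div_self (gpos m).ne').symm
      | succ j ih =>
        have := ih.mul (ratio.comp (tendsto_add_atTop_nat j))
        rw [pow_succ]
        refine this.congr fun m => ?_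
        have := (gpos (m + j)).ne'
        simp only [Function.comp]
        rw [← add_assoc]
        field_simp
    refine (this.comp (tendsto_sub_atTop_nat j)).congr' ?_
    filter_upwards [eventually_ge_atTop j] with m hm
    simp [Nat.sub_add_cancel hm]
  have psum : ∀ J, ∑ j ∈ Finset.range J, coeff j H * ρ ^ j ≤ w := by
    intro J
    have l : Tendsto (fun m => w ^ 2 + 2 * ∑ j ∈ Finset.range J, coeff j H *
        (coeff (m - j) g / coeff m g)) atTop
        (𝓝 (w ^ 2 + 2 * ∑ j ∈ Finset.range J, coeff j H * ρ ^ j)) :=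
      tendsto_const_nhds.add ((tendsto_finsetSum _ fun j _ => (rp j).const_mul _).const_mul 2)
    have := le_of_tendsto_of_tendsto l grat (by
      filter_upwards [eventually_ge_atTop (2 * J + 1)] with m hm
      rw [le_div_iff₀ (gpos m), gs, rec_H hH, if_neg (by omega)]
      have := coeff_mul_ge nH nH J m (by omega)
      have e : (∑ j ∈ Finset.range J, coeff j H * (coeff (m - j) g / coeff m g)) * coeff m g =
          ∑ j ∈ Finset.range J, coeff j H * coeff (m - j) H := by
        rw [Finset.sum_mul]
        refine Finset.sum_congr rfl fun j hj => ?_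
        have h1 := Finset.mem_range.1 hj
        have h2 := (gpos m).ne'
        rw [show m - j = (m - j - 1) + 1 by omega, gs]
        field_simp
      have e' : coeff m g = coeff m H := by
        rw [show m = (m - 1) + 1 by omega, gs]
      rw [add_mul, mul_assoc 2, e, e']
      linarith)
    rw [hα] at this
    nlinarith
  have sH : Summable fun m => coeff m H * ρ ^ m :=
    summable_of_sum_range_le (fun m => mul_nonneg (nH m) (pow_nonneg ρpos.le m)) psum
  obtain ⟨U, hU⟩ := sH
  have vU : Val ρ H U := hU
  have eqU : U = w ^ 2 * ρ + w ^ 2 * ρ * U + ρ * (U * U) := by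
    have nC := nn_C w2.le
    have a := (val_C ρ (w ^ 2)).mul ρpos.le nC nn_X (val_X ρ)
    have b := a.mul ρpos.le (nC.mul nn_X) nH vU
    have d := (val_X ρ).mul ρpos.le nn_X (nH.mul nH) (vU.mul ρpos.le nH nH vU)
    have := (a.add b).add d
    rw [← hH] at this
    exact vU.unique this
  have Uw : U = w := by
    rw [hρ] at eqU
    field_simp at eqU
    rw [hα] at eqU
    have : (U - w) ^ 2 = 0 := by linear_combination -eqU
    have := pow_eq_zero_iff (two_ne_zero) |>.1 this
    linarith
  rw [Uw] at vU
  refine ⟨gpos, ρpos, ratio, ?_, ?_⟩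
  · have := (val_C ρ 1).add vU
    simpa using this
  · have e : ∀ m, coeff (m + 1) (g * g) = coeff (m + 1 + 1) g + (2 - w ^ 2) * coeff (m + 1) g := by
      intro m
      have : g * g = 1 + C 2 * H + H * H := by rw [hg]; simp only [map_ofNat]; ring
      rw [this, gs, gs, map_add, map_add, coeff_C_mul, rec_H hH (m + 1), coeff_one, if_neg (by omega),
        if_neg (by omega)]
      ring
    rw [← tendsto_add_atTop_iff_nat 1]
    have l := (grat.comp (tendsto_add_atTop_nat 1)).add_const (2 - w ^ 2)
    rw [show 2 * (1 + w) = α + (2 - w ^ 2) by rw [hα]; ring]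
    refine l.congr fun m => ?_
    have := (gpos (m + 1)).ne'
    simp only [Function.comp]
    rw [e]
    field_simp

end
end S17

namespace S17
open PowerSeries Filter Topology

lemma Le.refl (u : ℝ⟦X⟧) : Le u u := fun _ => le_rfl
lemma Le.of_eq {u v : ℝ⟦X⟧} (h : u = v) : Le u v := h ▸ Le.refl u
lemma Le.trans {u v w : ℝ⟦X⟧} (h : Le u v) (h' : Le v w) : Le u w := fun m => (h m).trans (h' m)
lemma Le.add {u v u' v' : ℝ⟦X⟧} (h : Le u v) (h' : Le u' v') : Le (u + u') (v + v') := fun m => by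
  rw [map_add, map_add]; exact add_le_add (h m) (h' m)
lemma Le.mul {u v u' v' : ℝ⟦X⟧} (h : Le u v) (h' : Le u' v') (nu : Nn u') (nv : Nn v) :
    Le (u * u') (v * v') := fun m => by
  rw [coeff_mul, coeff_mul]
  exact Finset.sum_le_sum fun p _ => mul_le_mul (h _) (h' _) (nu _) (nv _)
lemma Nn.pow {u : ℝ⟦X⟧} (h : Nn u) (k : ℕ) : Nn (u ^ k) := by
  induction k with
  | zero => rw [pow_zero]; exact nn_one
  | succ k ih => rw [pow_succ]; exact ih.mul h

/-- Combinatorial classes. -/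
class CC (α : Type*) where
  sz : α → ℕ
  fin : ∀ m, {a : α | sz a = m}.Finite

open CC

/-- Generating function of a subset of a combinatorial class. -/
noncomputable def gf {α : Type*} [CC α] (S : Set α) : ℝ⟦X⟧ :=
  PowerSeries.mk fun m => (({a | a ∈ S ∧ sz a = m} : Set α).ncard : ℝ)

section
variable {α β : Type*} [CC α] [CC β]

lemma fin_slice (S : Set α) (m : ℕ) : ({a | a ∈ S ∧ sz a = m} : Set α).Finite :=
  (fin m).subset fun _ h => h.2

lemma coeff_gf (S : Set α) (m : ℕ) : coeff m (gf S) = (({a | a ∈ S ∧ sz a = m} : Set α).ncard : ℝ) := by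
  rw [gf, coeff_mk]

lemma nn_gf (S : Set α) : Nn (gf S) := fun m => by rw [coeff_gf]; positivity

lemma gf_mono {S T : Set α} (h : S ⊆ T) : Le (gf S) (gf T) := fun m => by
  rw [coeff_gf, coeff_gf]
  have : {a | a ∈ S ∧ sz a = m} ⊆ {a | a ∈ T ∧ sz a = m} := fun a ha => ⟨h ha.1, ha.2⟩
  exact_mod_cast Set.ncard_le_ncard this (fin_slice T m)

lemma gf_union {S T : Set α} (h : Disjoint S T) : gf (S ∪ T) = gf S + gf T := by
  ext m
  rw [map_add, coeff_gf, coeff_gf, coeff_gf, ← Nat.cast_add, ← Set.ncard_union_eq _ (fin_slice S m) (fin_slice T m)]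
  · congr 2; ext a; simp only [Set.mem_union, Set.mem_ofPred_eq]; tauto
  · rw [Set.disjoint_left] at h ⊢
    exact fun a ha hb => h ha.1 hb.1

lemma gf_union_le (S T : Set α) : Le (gf (S ∪ T)) (gf S + gf T) := fun m => by
  rw [map_add, coeff_gf, coeff_gf, coeff_gf, ← Nat.cast_add]
  refine Nat.cast_le.2 (le_trans (le_of_eq ?_) (Set.ncard_union_le _ _))
  congr 1; ext a; simp only [Set.mem_union, Set.mem_ofPred_eq]; tauto

lemma gf_empty : gf (∅ : Set α) = 0 := by
  ext m; rw [coeff_gf]; simp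

lemma gf_singleton (a : α) : gf {a} = X ^ (sz a) := by
  ext m
  rw [coeff_gf, coeff_X_pow]
  split_ifs with h
  · rw [show {x | x ∈ ({a} : Set α) ∧ sz x = m} = {a} by
      ext x; simp only [Set.mem_ofPred_eq, Set.mem_singleton_iff]; constructor
      · exact fun h => h.1
      · rintro rfl; exact ⟨rfl, h.symm⟩]
    simp
  · rw [show {x | x ∈ ({a} : Set α) ∧ sz x = m} = ∅ by
      ext x; simp only [Set.mem_ofPred_eq, Set.mem_singleton_iff, Set.mem_empty_iff_false, iff_false]
      rintro ⟨rfl, h'⟩; exact h h'.symm]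
    simp

instance : CC (α × β) where
  sz p := sz p.1 + sz p.2
  fin m := by
    have : ({p : α × β | sz p.1 + sz p.2 = m}) ⊆
        ⋃ i ∈ Finset.range (m + 1), ⋃ j ∈ Finset.range (m + 1), {a : α | sz a = i} ×ˢ {b : β | sz b = j} := by
      rintro ⟨a, b⟩ h
      simp only [Set.mem_ofPred_eq] at h
      simp only [Set.mem_iUnion, Finset.mem_range]
      exact ⟨sz a, by omega, sz b, by omega, rfl, rfl⟩
    refine Set.Finite.subset ?_ this
    refine Set.Finite.biUnion (Finset.finite_toSet _) fun i _ => ?_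
    exact Set.Finite.biUnion (Finset.finite_toSet _) fun j _ => (fin i).prod (fin j)

lemma sz_prod (p : α × β) : sz p = sz p.1 + sz p.2 := rfl

lemma gf_prod (S : Set α) (T : Set β) : gf (S ×ˢ T) = gf S * gf T := by
  classical
  ext m
  rw [coeff_mul, coeff_gf]
  have : {p : α × β | p ∈ S ×ˢ T ∧ sz p = m} =
      ⋃ i ∈ Finset.HasAntidiagonal.antidiagonal m, {a | a ∈ S ∧ sz a = i.1} ×ˢ {b | b ∈ T ∧ sz b = i.2} := by
    ext ⟨a, b⟩
    simp only [Set.mem_iUnion, Finset.HasAntidiagonal.mem_antidiagonal, Set.mem_ofPred_eq, sz_prod,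
      Set.mem_prod]
    constructor
    · rintro ⟨⟨ha, hb⟩, h⟩
      exact ⟨(sz a, sz b), h, ⟨ha, rfl⟩, ⟨hb, rfl⟩⟩
    · rintro ⟨i, h, ⟨h1, h2⟩, ⟨h3, h4⟩⟩
      exact ⟨⟨h1, h3⟩, by rw [h2, h4, h]⟩
  have hf : ∀ i : ℕ × ℕ, ({a | a ∈ S ∧ sz a = i.1} ×ˢ {b | b ∈ T ∧ sz b = i.2} : Set (α × β)).Finite :=
    fun i => (fin_slice S _).prod (fin_slice T _)
  have e : {p : α × β | p ∈ S ×ˢ T ∧ sz p = m} =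
      ((Finset.HasAntidiagonal.antidiagonal m).biUnion fun i => (hf i).toFinset : Finset (α × β)) := by
    rw [this]; simp
  rw [e, Set.ncard_coe_finset, Finset.card_biUnion]
  · push_cast
    refine Finset.sum_congr rfl fun i _ => ?_
    rw [coeff_gf, coeff_gf, ← Nat.cast_mul, ← Set.ncard_prod, Set.ncard_eq_toFinset_card _ (hf i)]
  · intro i _ j _ hij
    rw [Function.onFun, Finset.disjoint_left]
    rintro ⟨a, b⟩ h1 h2
    simp only [Set.Finite.mem_toFinset, Set.mem_prod, Set.mem_ofPred_eq] at h1 h2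
    exact hij (Prod.ext (h1.1.2.symm.trans h2.1.2) (h1.2.2.symm.trans h2.2.2))

lemma coeff_X_pow_mul_gf (S : Set α) (k m : ℕ) : coeff m (X ^ k * gf S) =
    (({a | a ∈ S ∧ sz a + k = m} : Set α).ncard : ℝ) := by
  rw [coeff_X_pow_mul', coeff_gf]
  split_ifs with h
  · congr 2; ext a; simp only [Set.mem_ofPred_eq]; refine and_congr_right fun _ => ?_; omega
  · rw [show {a | a ∈ S ∧ sz a + k = m} = ∅ by
      ext a; simp only [Set.mem_ofPred_eq, Set.mem_empty_iff_false, iff_false]; omega]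
    simp

lemma gf_cover {S : Set α} {T : Set β} (f : α → β) (k : ℕ) (hf : ∀ a ∈ S, sz (f a) = sz a + k)
    (h : ∀ b ∈ T, ∃ a ∈ S, f a = b) : Le (gf T) (X ^ k * gf S) := fun m => by
  rw [coeff_X_pow_mul_gf, coeff_gf]
  have fs : ({a | a ∈ S ∧ sz a + k = m} : Set α).Finite :=
    (fin (m - k)).subset fun a h => by have := h.2; simp only [Set.mem_ofPred_eq]; omega
  have : {b | b ∈ T ∧ sz b = m} ⊆ f '' {a | a ∈ S ∧ sz a + k = m} := by
    rintro b ⟨h1, h2⟩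
    obtain ⟨a, ha, rfl⟩ := h b h1
    exact ⟨a, ⟨ha, by rw [← hf a ha, h2]⟩, rfl⟩
  exact_mod_cast (Set.ncard_le_ncard this (fs.image f)).trans (Set.ncard_image_le fs)

lemma gf_inj {S : Set α} {T : Set β} (f : α → β) (k : ℕ) (hf : ∀ a ∈ S, sz (f a) = sz a + k)
    (h : ∀ a ∈ S, f a ∈ T) (hi : Set.InjOn f S) : Le (X ^ k * gf S) (gf T) := fun m => by
  rw [coeff_X_pow_mul_gf, coeff_gf]
  have : f '' {a | a ∈ S ∧ sz a + k = m} ⊆ {b | b ∈ T ∧ sz b = m} := by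
    rintro b ⟨a, ⟨ha, ha'⟩, rfl⟩
    exact ⟨h a ha, by rw [hf a ha, ha']⟩
  rw [← Set.InjOn.ncard_image (hi.mono fun a ha => ha.1)]
  exact_mod_cast Set.ncard_le_ncard this (fin_slice T m)

lemma Le.antisymm {u v : ℝ⟦X⟧} (h : Le u v) (h' : Le v u) : u = v := by
  ext m; exact le_antisymm (h m) (h' m)

lemma gf_bij {S : Set α} {T : Set β} (f : α → β) (k : ℕ) (hf : ∀ a ∈ S, sz (f a) = sz a + k)
    (h : ∀ a ∈ S, f a ∈ T) (hi : Set.InjOn f S) (hs : ∀ b ∈ T, ∃ a ∈ S, f a = b) :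
    gf T = X ^ k * gf S := (gf_cover f k hf hs).antisymm (gf_inj f k hf h hi)

lemma gf_biUnion {ι : Type*} [DecidableEq ι] (I : Finset ι) (S : ι → Set α)
    (hd : ∀ i ∈ I, ∀ j ∈ I, i ≠ j → Disjoint (S i) (S j)) :
    gf (⋃ i ∈ I, S i) = ∑ i ∈ I, gf (S i) := by
  induction I using Finset.induction_on with
  | empty => simp [gf_empty]
  | insert a s ha ih =>
    rw [Finset.sum_insert ha, Finset.set_biUnion_insert, gf_union, ih]
    · exact fun i hi j hj => hd i (Finset.mem_insert_of_mem hi) j (Finset.mem_insert_of_mem hj)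
    · simp only [Set.disjoint_iUnion_right]
      intro i hi
      exact hd a (Finset.mem_insert_self _ _) i (Finset.mem_insert_of_mem hi)
        (fun h => ha (h ▸ hi))

open Classical in
/-- Splitting according to the value of a finite statistic. -/
lemma gf_fiber {φ : Type*} [Fintype φ] (S : Set α) (e : α → φ) (P : Set φ) :
    gf {a | a ∈ S ∧ e a ∈ P} = ∑ f ∈ Finset.univ.filter (· ∈ P), gf {a | a ∈ S ∧ e a ∈ ({f} : Set φ)} := by
  rw [← gf_biUnion]
  · congr 1; ext a; simp
  · intro i _ j _ hij
    rw [Set.disjoint_left]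
    rintro a ⟨_, h1⟩ ⟨_, h2⟩
    exact hij ((Set.mem_singleton_iff.1 h1).symm.trans h2)

end
end S17

namespace S17
open PowerSeries Filter Topology
open CC AT

variable {n : ℕ}

lemma size_pos (t : AT n) : 1 ≤ size t := by
  cases t <;> simp [size]

lemma sizeList_nil : sizeList ([] : List (AT n)) = 0 := by simp [sizeList]
lemma sizeList_cons (t : AT n) (ts) : sizeList (t :: ts) = size t + sizeList ts := by simp [sizeList]
lemma size_node (c) (ts : List (AT n)) : size (AT.node c ts) = sizeList ts + 1 := by
  simp [size, add_comm]
lemma size_leaf (i : Fin n) (b) : size (AT.leaf i b) = 1 := by simp [size]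

lemma sizeList_append (l l' : List (AT n)) : sizeList (l ++ l') = sizeList l + sizeList l' := by
  induction l with
  | nil => simp [sizeList_nil]
  | cons t l ih => simp [sizeList_cons, ih, add_assoc]

lemma size_le_of_mem {t : AT n} {ts} (h : t ∈ ts) : size t ≤ sizeList ts := by
  induction ts with
  | nil => simp at h
  | cons s ts ih =>
    rw [sizeList_cons]
    rcases List.mem_cons.1 h with rfl | h
    · omega
    · have := ih h; omega

theorem at_ind {P : AT n → Prop} (hl : ∀ i b, P (.leaf i b))
    (hn : ∀ c ts, (∀ t ∈ ts, P t) → P (.node c ts)) (t : AT n) : P t := by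
  have : ∀ m, ∀ t : AT n, size t ≤ m → P t := by
    intro m
    induction m with
    | zero => intro t h; have := size_pos t; omega
    | succ m ih =>
      intro t h
      cases t with
      | leaf i b => exact hl i b
      | node c ts =>
        refine hn c ts fun s hs => ih s ?_
        have := size_le_of_mem hs
        rw [size_node] at h
        omega
  exact this _ t le_rfl

lemma fin_aux (m : ℕ) : {t : AT n | size t ≤ m}.Finite ∧ {ts : List (AT n) | sizeList ts ≤ m}.Finite := by
  induction m with
  | zero =>
    constructor
    · convert Set.finite_empty (α := AT n)
      ext t
      have := size_pos t
      simp only [Set.mem_ofPred_eq, Set.mem_empty_iff_false, iff_false]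
      omega
    · refine (Set.finite_singleton ([] : List (AT n))).subset fun ts h => ?_
      cases ts with
      | nil => rfl
      | cons t ts =>
        simp only [Set.mem_ofPred_eq, sizeList_cons] at h
        have := size_pos t
        omega
  | succ m ih =>
    have h1 : {t : AT n | size t ≤ m + 1}.Finite := by
      have f1 := Set.finite_range (fun p : Fin n × Bool => AT.leaf p.1 p.2)
      have f2 := (Set.finite_univ (α := Bool)).image2 (fun c ts => AT.node (n := n) c ts) ih.2
      refine (f1.union f2).subset fun t h => ?_
      cases t with
      | leaf i b => exact Or.inl ⟨(i, b), rfl⟩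
      | node c ts =>
        refine Or.inr ⟨c, trivial, ts, ?_, rfl⟩
        simp only [Set.mem_ofPred_eq, size_node] at h ⊢
        omega
    refine ⟨h1, ?_⟩
    refine ((Set.finite_singleton ([] : List (AT n))).union (h1.image2 (fun t ts => t :: ts) ih.2)).subset fun ts h => ?_
    cases ts with
    | nil => exact Or.inl rfl
    | cons t ts =>
      simp only [Set.mem_ofPred_eq, sizeList_cons] at h
      have := size_pos t
      refine Or.inr ⟨t, ?_, ts, ?_, rfl⟩ <;> simp only [Set.mem_ofPred_eq] <;> omega

instance : CC (AT n) where
  sz := size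
  fin m := (fin_aux m).1.subset fun t h => by
    simp only [Set.mem_ofPred_eq] at h ⊢; omega

instance : CC (List (AT n)) where
  sz := sizeList
  fin m := (fin_aux m).2.subset fun t h => by
    simp only [Set.mem_ofPred_eq] at h ⊢; omega

lemma sz_at (t : AT n) : sz t = size t := rfl
lemma sz_list (t : List (AT n)) : sz t = sizeList t := rfl

/-- Boolean functions. -/
abbrev BF (n : ℕ) := (Fin n → Bool) → Bool

def op (c : Bool) (p q : BF n) : BF n := fun x => if c then p x && q x else p x || q x

lemma eval_node (c) (ts : List (AT n)) : eval (.node c ts) = evalList c ts := by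
  funext x; simp [eval]
lemma eval_leaf (i : Fin n) (b) (x) : eval (.leaf i b) x = (if b then x i else ! x i) := by
  simp [eval]
lemma evalList_nil (c) : evalList c ([] : List (AT n)) = fun _ => c := by
  funext x; simp [evalList]
lemma evalList_cons (c) (t : AT n) (ts) : evalList c (t :: ts) = op c (eval t) (evalList c ts) := by
  funext x; simp [evalList, op]
lemma evalList_single (c) (t : AT n) : evalList c [t] = eval t := by
  funext x; rw [evalList_cons, evalList_nil]; cases c <;> simp [op]
lemma evalList_true (ts : List (AT n)) (x) : evalList true ts x = true ↔ ∀ t ∈ ts, eval t x = true := by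
  induction ts with
  | nil => simp [evalList_nil]
  | cons t ts ih => simp [evalList_cons, op, ih]
lemma evalList_false (ts : List (AT n)) (x) : evalList false ts x = true ↔ ∃ t ∈ ts, eval t x = true := by
  induction ts with
  | nil => simp [evalList_nil]
  | cons t ts ih => simp [evalList_cons, op, ih]

def K0 (n : ℕ) (c : Bool) : Set (AT n) := {t | WF t ∧ rootConn t ≠ some c}
def N0 (n : ℕ) (c : Bool) : Set (AT n) := {t | WF t ∧ rootConn t = some c}
def V0 (n : ℕ) : Set (AT n) := {t | rootConn t = none}
def L0 (n : ℕ) (c : Bool) : Set (List (AT n)) := {ts | ∀ t ∈ ts, t ∈ K0 n c}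
def H0 (n : ℕ) (c : Bool) : Set (List (AT n)) := {ts | ts ∈ L0 n c ∧ ts ≠ []}
def T0 (n : ℕ) (c : Bool) : Set (List (AT n)) := {ts | ts ∈ L0 n c ∧ 2 ≤ ts.length}

def Kp (c : Bool) (P : Set (BF n)) : Set (AT n) := {t | t ∈ K0 n c ∧ eval t ∈ P}
def Np (c : Bool) (P : Set (BF n)) : Set (AT n) := {t | t ∈ N0 n c ∧ eval t ∈ P}
def Vp (P : Set (BF n)) : Set (AT n) := {t | t ∈ V0 n ∧ eval t ∈ P}
def Lp (c : Bool) (P : Set (BF n)) : Set (List (AT n)) := {t | t ∈ L0 n c ∧ evalList c t ∈ P}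
def Hp (c : Bool) (P : Set (BF n)) : Set (List (AT n)) := {t | t ∈ H0 n c ∧ evalList c t ∈ P}
def Tp (c : Bool) (P : Set (BF n)) : Set (List (AT n)) := {t | t ∈ T0 n c ∧ evalList c t ∈ P}

lemma wf_node {c : Bool} {ts : List (AT n)} : WF (AT.node c ts) ↔ ts ∈ T0 n c := by
  constructor
  · rintro (_ | ⟨_, _, h1, h2, h3⟩)
    exact ⟨fun t ht => ⟨h2 t ht, h3 t ht⟩, h1⟩
  · rintro ⟨h1, h2⟩
    exact WF.node c ts h2 (fun t ht => (h1 t ht).1) (fun t ht => (h1 t ht).2)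

lemma mem_N0 {c : Bool} {t : AT n} : t ∈ N0 n c ↔ ∃ ts ∈ T0 n c, t = .node c ts := by
  constructor
  · rintro ⟨h1, h2⟩
    cases t with
    | leaf i b => simp [rootConn] at h2
    | node c' ts =>
      simp only [rootConn, Option.some.injEq] at h2
      subst h2
      exact ⟨ts, wf_node.1 h1, rfl⟩
  · rintro ⟨ts, h, rfl⟩
    exact ⟨wf_node.2 h, rfl⟩

lemma mem_K0 {c : Bool} {t : AT n} : t ∈ K0 n c ↔ t ∈ V0 n ∨ t ∈ N0 n (!c) := by
  constructor
  · rintro ⟨h1, h2⟩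
    cases t with
    | leaf i b => left; rfl
    | node c' ts =>
      right; refine ⟨h1, ?_⟩
      simp only [rootConn, ne_eq, Option.some.injEq] at h2 ⊢
      cases c <;> cases c' <;> simp_all
  · rintro (h | ⟨h1, h2⟩)
    · cases t with
      | leaf i b => exact ⟨WF.leaf i b, by simp [rootConn]⟩
      | node c' ts => simp [V0, rootConn] at h
    · refine ⟨h1, ?_⟩
      rw [h2]; cases c <;> simp

lemma mem_V0 {t : AT n} : t ∈ V0 n ↔ ∃ i b, t = .leaf i b := by
  cases t with
  | leaf i b => simp [V0, rootConn]
  | node c ts => simp [V0, rootConn]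

lemma gf_Np (c) (P : Set (BF n)) : gf (Np c P) = X * gf (Tp c P) := by
  rw [← pow_one X]
  refine gf_bij (AT.node c) 1 ?_ ?_ ?_ ?_
  · intro a _; rw [sz_at, size_node]; rfl
  · rintro a ⟨h1, h2⟩
    exact ⟨mem_N0.2 ⟨a, h1, rfl⟩, by rwa [eval_node]⟩
  · intro a _ b _ h; simpa using h
  · rintro b ⟨h1, h2⟩
    obtain ⟨ts, h, rfl⟩ := mem_N0.1 h1
    exact ⟨ts, ⟨h, by rwa [eval_node] at h2⟩, rfl⟩

lemma gf_Kp (c) (P : Set (BF n)) : gf (Kp c P) = gf (Vp P) + gf (Np (!c) P) := by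
  rw [← gf_union]
  · congr 1; ext t
    simp only [Kp, Vp, Np, Set.mem_union, Set.mem_ofPred_eq, mem_K0]
    tauto
  · rw [Set.disjoint_left]
    rintro t ⟨h1, _⟩ ⟨h2, _⟩
    have a : rootConn t = none := h1
    have b : rootConn t = some (!c) := h2.2
    rw [a] at b; simp at b

lemma mem_H0 {c : Bool} {t : AT n} {ts} : t :: ts ∈ H0 n c ↔ t ∈ K0 n c ∧ ts ∈ L0 n c := by
  simp [H0, L0]

lemma mem_L0_append {c : Bool} {l l' : List (AT n)} : l ++ l' ∈ L0 n c ↔ l ∈ L0 n c ∧ l' ∈ L0 n c := by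
  simp only [L0, Set.mem_ofPred_eq, List.mem_append]
  constructor
  · exact fun h => ⟨fun t ht => h t (Or.inl ht), fun t ht => h t (Or.inr ht)⟩
  · rintro ⟨h1, h2⟩ t (ht | ht)
    exacts [h1 t ht, h2 t ht]

lemma mem_L0_cons {c : Bool} {t : AT n} {ts} : t :: ts ∈ L0 n c ↔ t ∈ K0 n c ∧ ts ∈ L0 n c := by
  simp [L0]

lemma nil_L0 {c : Bool} : [] ∈ L0 n c := by simp [L0]

lemma mem_T0 {c : Bool} {t : AT n} {ts} : t :: ts ∈ T0 n c ↔ t ∈ K0 n c ∧ ts ∈ H0 n c := by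
  simp only [T0, H0, Set.mem_ofPred_eq, mem_L0_cons, List.length_cons]
  rw [← List.length_pos_iff_ne_nil, and_assoc]
  refine and_congr_right fun _ => and_congr_right fun _ => ?_
  omega

lemma gf_Hp (c) (P : Set (BF n)) : gf (Hp c P) = gf (Kp c P) + gf (Tp c P) := by
  have e : gf {l : List (AT n) | ∃ t ∈ Kp c P, l = [t]} = gf (Kp c P) := by
    rw [← one_mul (gf (Kp c P)), ← pow_zero X]
    refine gf_bij (fun t => [t]) 0 ?_ ?_ ?_ ?_
    · intro a _; rw [sz_list, sizeList_cons, sizeList_nil]; rfl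
    · intro a ha; exact ⟨a, ha, rfl⟩
    · intro a _ b _ h; simpa using h
    · rintro b ⟨t, ht, rfl⟩; exact ⟨t, ht, rfl⟩
  rw [← e, ← gf_union]
  · congr 1; ext l
    simp only [Hp, Tp, Set.mem_union, Set.mem_ofPred_eq]
    rcases l with _ | ⟨t, _ | ⟨s, l⟩⟩
    · simp [H0, T0]
    · rw [mem_H0, mem_T0, evalList_single]
      simp [H0, nil_L0, Kp]
    · rw [mem_H0, mem_T0]
      simp [H0]
  · rw [Set.disjoint_left]
    rintro l ⟨t, _, rfl⟩ ⟨h, _⟩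
    have := h.2
    simp at this

lemma gf_Lp (c) (P : Set (BF n)) : gf (Lp c P) = (open Classical in if (fun _ => c) ∈ P then 1 else 0) + gf (Hp c P) := by
  classical
  have e : gf {l : List (AT n) | l = [] ∧ (fun _ => c) ∈ P} = (if (fun _ => c) ∈ P then 1 else 0) := by
    split_ifs with h
    · rw [show {l : List (AT n) | l = [] ∧ (fun _ => c) ∈ P} = {[]} by ext; simp [h], gf_singleton]
      rw [sz_list, sizeList_nil, pow_zero]
    · rw [← gf_empty (α := List (AT n))]; congr 1; ext; simp [h]
  rw [← e, ← gf_union]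
  · congr 1; ext l
    simp only [Hp, Lp, Set.mem_union, Set.mem_ofPred_eq]
    rcases l with _ | ⟨t, l⟩
    · simp [H0, nil_L0, evalList_nil]
    · rw [mem_H0, mem_L0_cons]; simp
  · rw [Set.disjoint_left]
    rintro l ⟨rfl, _⟩ ⟨h, _⟩
    exact h.2 rfl

open Classical in
lemma gf_Tp (c) (P : Set (BF n)) : gf (Tp c P) =
    ∑ pq ∈ Finset.univ.filter (fun pq : BF n × BF n => op c pq.1 pq.2 ∈ P),
      gf (Kp c {pq.1}) * gf (Hp c {pq.2}) := by
  have e : gf (Tp c P) = X ^ 0 * gf {a : AT n × List (AT n) | a ∈ K0 n c ×ˢ H0 n c ∧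
      (eval a.1, evalList c a.2) ∈ {pq : BF n × BF n | op c pq.1 pq.2 ∈ P}} := by
    refine gf_bij (fun a => a.1 :: a.2) 0 ?_ ?_ ?_ ?_
    · intro a _; rw [sz_list, sizeList_cons]; rfl
    · rintro ⟨t, ts⟩ ⟨⟨h1, h2⟩, h3⟩
      refine ⟨mem_T0.2 ⟨h1, h2⟩, ?_⟩
      rw [evalList_cons]; exact h3
    · rintro ⟨t, ts⟩ _ ⟨t', ts'⟩ _ h
      simpa using h
    · rintro b ⟨h1, h2⟩
      cases b with
      | nil => have := h1.2; simp at this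
      | cons t ts =>
        rw [mem_T0] at h1
        rw [evalList_cons] at h2
        exact ⟨(t, ts), ⟨⟨h1.1, h1.2⟩, h2⟩, rfl⟩
  rw [e, pow_zero, one_mul, gf_fiber (K0 n c ×ˢ H0 n c) (fun a => (eval a.1, evalList c a.2))]
  refine Finset.sum_congr rfl fun pq _ => ?_
  rw [← gf_prod]
  congr 1
  ext ⟨t, ts⟩
  obtain ⟨p, q⟩ := pq
  simp only [Set.mem_ofPred_eq, Set.mem_prod, Set.mem_singleton_iff, Prod.mk.injEq, Kp, Hp]
  tauto

open Classical in
lemma gf_Kp_sum (c) (P : Set (BF n)) : gf (Kp c P) = ∑ f ∈ Finset.univ.filter (· ∈ P), gf (Kp c {f}) :=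
  gf_fiber (K0 n c) eval P
open Classical in
lemma gf_Hp_sum (c) (P : Set (BF n)) : gf (Hp c P) = ∑ f ∈ Finset.univ.filter (· ∈ P), gf (Hp c {f}) :=
  gf_fiber (H0 n c) (evalList c) P

lemma gf_V0 : gf (V0 n) = C (2 * (n : ℝ)) * X := by
  ext m
  rw [coeff_gf, coeff_C_mul, coeff_X]
  split_ifs with h
  · have : {a | a ∈ V0 n ∧ sz a = m} = (fun p : Fin n × Bool => AT.leaf p.1 p.2) '' Set.univ := by
      ext t
      simp only [Set.mem_ofPred_eq, mem_V0, Set.mem_image, Set.mem_univ, true_and, Prod.exists]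
      constructor
      · rintro ⟨⟨i, b, rfl⟩, _⟩; exact ⟨i, b, rfl⟩
      · rintro ⟨i, b, rfl⟩; exact ⟨⟨i, b, rfl⟩, by rw [sz_at, size_leaf, h]⟩
    rw [this, Set.InjOn.ncard_image, Set.ncard_univ, Nat.card_eq_fintype_card]
    · simp; ring
    · rintro ⟨i, b⟩ _ ⟨i', b'⟩ _ h; simpa using h
  · have : {a | a ∈ V0 n ∧ sz a = m} = ∅ := by
      ext t
      simp only [Set.mem_ofPred_eq, mem_V0, Set.mem_empty_iff_false, iff_false]
      rintro ⟨⟨i, b, rfl⟩, h'⟩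
      rw [sz_at, size_leaf] at h'; exact h h'.symm
    rw [this]; simp

/-! Duality -/
mutual
def dual {n : ℕ} : AT n → AT n
  | .leaf i b => .leaf i b
  | .node c ts => .node (!c) (dualList ts)
def dualList {n : ℕ} : List (AT n) → List (AT n)
  | [] => []
  | t :: ts => dual t :: dualList ts
end

lemma dualList_eq (ts : List (AT n)) : dualList ts = ts.map dual := by
  induction ts with
  | nil => simp [dualList]
  | cons t ts ih => simp [dualList, ih]

lemma dual_node (c) (ts : List (AT n)) : dual (.node c ts) = .node (!c) (ts.map dual) := by
  rw [dual, dualList_eq]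

lemma dual_leaf (i : Fin n) (b) : dual (.leaf i b) = .leaf i b := by rw [dual]

lemma dual_dual (t : AT n) : dual (dual t) = t := by
  induction t using at_ind with
  | hl i b => simp [dual_leaf]
  | hn c ts ih =>
    rw [dual_node, dual_node, Bool.not_not, List.map_map]
    congr 1
    conv_rhs => rw [← List.map_id ts]
    exact List.map_congr_left fun t ht => ih t ht

lemma size_dual (t : AT n) : size (dual t) = size t := by
  induction t using at_ind with
  | hl i b => simp [dual_leaf]
  | hn c ts ih =>
    rw [dual_node, size_node, size_node]
    congr 1
    induction ts with
    | nil => rfl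
    | cons t ts ih' =>
      rw [List.map_cons, sizeList_cons, sizeList_cons, ih t (by simp), ih' fun s hs => ih s (by simp [hs])]

lemma rootConn_dual (t : AT n) : rootConn (dual t) = (rootConn t).map (!·) := by
  cases t with
  | leaf i b => simp [dual_leaf, rootConn]
  | node c ts => simp [dual_node, rootConn]

lemma wf_dual {t : AT n} (h : WF t) : WF (dual t) := by
  induction t using at_ind with
  | hl i b => rw [dual_leaf]; exact h
  | hn c ts ih =>
    rw [dual_node, wf_node]
    rw [wf_node] at h
    refine ⟨?_, by simpa using h.2⟩
    intro s hs
    obtain ⟨t, ht, rfl⟩ := List.mem_map.1 hs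
    have := h.1 t ht
    refine ⟨ih t ht this.1, ?_⟩
    have h2 := this.2
    rw [rootConn_dual]
    cases e : rootConn t with
    | none => simp
    | some d => rw [e] at h2; simpa using h2

/-- Dual Boolean function. -/
def df (f : BF n) : BF n := fun x => ! f (fun i => ! x i)

lemma df_df (f : BF n) : df (df f) = f := by funext x; simp [df]

lemma eval_dual (t : AT n) : eval (dual t) = df (eval t) := by
  induction t using at_ind with
  | hl i b => funext x; simp only [dual_leaf, df, eval_leaf]; cases b <;> simp
  | hn c ts ih =>
    rw [dual_node, eval_node, eval_node]
    induction ts with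
    | nil => funext x; simp [evalList_nil, df]
    | cons t ts ih' =>
      rw [List.map_cons, evalList_cons, evalList_cons, ih t (by simp), ih' fun s hs => ih s (by simp [hs])]
      funext x
      cases c <;> simp [op, df]

lemma dual_N0 {c} {t : AT n} (h : t ∈ N0 n c) : dual t ∈ N0 n (!c) :=
  ⟨wf_dual h.1, by rw [rootConn_dual, h.2]; rfl⟩

lemma gf_dual (c) (P : Set (BF n)) : gf (Np (!c) P) = gf (Np c (df ⁻¹' P)) := by
  rw [← one_mul (gf (Np c _)), ← pow_zero X]
  refine gf_bij dual 0 ?_ ?_ ?_ ?_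
  · intro a _; exact size_dual a
  · rintro a ⟨h1, h2⟩
    exact ⟨dual_N0 h1, by rw [eval_dual]; exact h2⟩
  · intro a _ b _ h
    rw [← dual_dual a, h, dual_dual]
  · rintro b ⟨h1, h2⟩
    refine ⟨dual b, ⟨?_, ?_⟩, dual_dual b⟩
    · have := dual_N0 h1; rwa [Bool.not_not] at this
    · rw [eval_dual, Set.mem_preimage, df_df]; exact h2

end S17

namespace S17
open PowerSeries Filter Topology
open CC AT

lemma Val.of_le {ρ V : ℝ} {u v : ℝ⟦X⟧} (hρ : 0 ≤ ρ) (nu : Nn u) (hl : Le u v) (hv : Val ρ v V) :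
    ∃ U, Val ρ u U :=
  Summable.of_nonneg_of_le (fun m => mul_nonneg (nu m) (pow_nonneg hρ m))
    (fun m => mul_le_mul_of_nonneg_right (hl m) (pow_nonneg hρ m)) hv.summable

variable {n : ℕ}

lemma X_cancel {u v : ℝ⟦X⟧} (h : X * u = X * v) : u = v := by
  ext m
  have := congrArg (coeff (m + 1)) h
  rwa [coeff_succ_X_mul, coeff_succ_X_mul] at this

lemma gf_Np_univ (c) : gf (Np (n := n) c Set.univ) = gf (Np (n := n) true Set.univ) := by
  cases c
  · have := gf_dual (n := n) true Set.univ
    simpa using this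
  · rfl
lemma gf_Tp_univ (c) : gf (Tp (n := n) c Set.univ) = gf (Tp (n := n) true Set.univ) := by
  apply X_cancel
  rw [← gf_Np, ← gf_Np, gf_Np_univ]
lemma gf_Kp_univ (c) : gf (Kp (n := n) c Set.univ) = gf (Kp (n := n) true Set.univ) := by
  rw [gf_Kp, gf_Kp, gf_Np_univ, gf_Np_univ (!true)]
lemma gf_Hp_univ (c) : gf (Hp (n := n) c Set.univ) = gf (Hp (n := n) true Set.univ) := by
  rw [gf_Hp, gf_Hp, gf_Tp_univ, gf_Kp_univ]

lemma gf_Tp_tot (c) : gf (Tp (n := n) c Set.univ) = gf (Kp (n := n) c Set.univ) * gf (Hp (n := n) c Set.univ) := by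
  classical
  rw [gf_Tp, gf_Kp_sum, gf_Hp_sum, Finset.sum_mul_sum, ← Finset.sum_product']
  refine Finset.sum_congr ?_ fun _ _ => rfl
  ext; simp

/-- Total generating functions. -/
noncomputable def gB (n : ℕ) : ℝ⟦X⟧ := gf (Kp (n := n) true Set.univ)
noncomputable def gH (n : ℕ) : ℝ⟦X⟧ := gf (Hp (n := n) true Set.univ)
noncomputable def gT (n : ℕ) : ℝ⟦X⟧ := gf (Tp (n := n) true Set.univ)
noncomputable def gA (n : ℕ) : ℝ⟦X⟧ := gf (Np (n := n) true Set.univ)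
noncomputable def gG (n : ℕ) : ℝ⟦X⟧ := 1 + gH n
noncomputable def gV (n : ℕ) : ℝ⟦X⟧ := gf (V0 n)
noncomputable def wv (n : ℕ) : ℝ := Real.sqrt (2 * n)
noncomputable def rh (n : ℕ) : ℝ := 1 / (wv n * (wv n + 2))

lemma wv_sq : wv n ^ 2 = 2 * n := Real.sq_sqrt (by positivity)

lemma wv_gt (hn : 1 ≤ n) : 1 < wv n := by
  rw [wv, Real.lt_sqrt (by norm_num)]
  have : (1 : ℝ) ≤ n := by exact_mod_cast hn
  linarith

lemma Vp_univ : Vp (n := n) Set.univ = V0 n := by ext; simp [Vp]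

lemma gB_eq : gB n = gV n + gA n := by
  rw [gB, gf_Kp, Vp_univ, gf_Np_univ]; rfl
lemma gA_eq : gA n = X * gT n := gf_Np _ _
lemma gT_eq : gT n = gB n * gH n := gf_Tp_tot _
lemma gH_eq : gH n = gB n + gT n := gf_Hp _ _
lemma gV_eq : gV n = C (wv n ^ 2) * X := by rw [wv_sq]; exact gf_V0
lemma gL_eq (c) : gf (Lp (n := n) c Set.univ) = gG n := by
  rw [gf_Lp, gf_Hp_univ, if_pos (Set.mem_univ _)]; rfl

lemma H_quad : gH n = C (wv n ^ 2) * X + C (wv n ^ 2) * X * gH n + X * (gH n * gH n) := by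
  rw [← gV_eq]
  have e1 := gB_eq (n := n)
  rw [gA_eq] at e1
  have e3 := gH_eq (n := n)
  have e4 := e3
  rw [gT_eq] at e4
  linear_combination (1 + gH n) * e1 - X * (1 + gH n) * e3 + (1 + X) * e4

lemma ctx (hn : 1 ≤ n) : Ctx (gG n) (rh n) (1 + wv n) :=
  ctx_of_H (wv_gt hn) (nn_gf _) H_quad

lemma rh_pos (hn : 1 ≤ n) : 0 < rh n := (ctx hn).rpos

lemma rh_lt (hn : 1 ≤ n) : rh n < 1 := by
  have := wv_gt hn
  rw [rh, div_lt_one (by positivity)]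
  nlinarith

lemma reg_H (hn : 1 ≤ n) : Reg (gG n) (rh n) (gH n) (wv n) 1 := by
  have h := (ctx hn).reg
  have : gG n = gH n + 1 := by rw [gG, add_comm]
  nth_rewrite 2 [this] at h
  exact (h.sub (reg_one (ctx hn)) (nn_gf _)).congr (by ring) (by ring)

lemma H_le_G : Le (gH n) (gG n) := fun m => by
  rw [gG, map_add]; linarith [nn_one m]

lemma B_le_H : Le (gB n) (gH n) := fun m => by
  rw [gH_eq, map_add]; linarith [nn_gf (Tp (n := n) true Set.univ) m, show coeff m (gT n) = coeff m (gf (Tp (n := n) true Set.univ)) from rfl]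

lemma reg_B (hn : 1 ≤ n) : Reg (gG n) (rh n) (gB n) (wv n / (1 + wv n)) (rh n / (1 + rh n)) := by
  have c := ctx hn
  have hw := wv_gt hn
  have hρ := rh_pos hn
  refine ⟨nn_gf _, ?_, ?_⟩
  · obtain ⟨U, hU⟩ := Val.of_le hρ.le (nn_gf _) B_le_H (reg_H hn).val
    have h1 := hU.add (hU.mul hρ.le (nn_gf _) (nn_gf _) (reg_H hn).val)
    have e : gH n = gB n + gB n * gH n := by rw [← gT_eq, ← gH_eq]
    have h2 := (reg_H hn).val
    rw [e] at h2
    have := h2.unique h1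
    rw [show wv n / (1 + wv n) = U by rw [div_eq_iff (by positivity)]; linarith]
    exact hU
  · rw [← tendsto_add_atTop_iff_nat 1, ← tendsto_sub_nhds_zero_iff]
    apply (tendsto_zero_iff_abs_tendsto_zero _).2
    refine contraction (θ := rh n)
      (ε := fun k => |coeff (k + 1) (gG n) / coeff (k + 1 + 1) (gG n) - rh n|) hρ.le (rh_lt hn)
      (fun k => abs_nonneg _) ?_ ?_
    · intro k
      simp only [Function.comp]
      set y := coeff (k + 1) (gB n) / coeff (k + 1) (gG n) with hy
      set κ := coeff (k + 1) (gG n) / coeff (k + 1 + 1) (gG n) with hκ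
      have p1 := c.pos (k + 1)
      have p2 := c.pos (k + 1 + 1)
      have y0 : 0 ≤ y := div_nonneg (nn_gf _ _) p1.le
      have y1 : y ≤ 1 := by
        rw [hy, div_le_one p1]
        exact (B_le_H.trans H_le_G) _
      have e : coeff (k + 1 + 1) (gB n) = coeff (k + 1) (gG n) - coeff (k + 1) (gB n) := by
        have a : gG n = 1 + (gB n + gT n) := by rw [gG, gH_eq]
        conv_lhs => rw [gB_eq, gA_eq, gV_eq]
        rw [a]
        simp only [map_add, coeff_succ_X_mul, coeff_C_mul, coeff_X, coeff_one]
        simp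
      have e2 : coeff (k + 1 + 1) (gB n) / coeff (k + 1 + 1) (gG n) = κ * (1 - y) := by
        rw [e, hκ, hy]; field_simp
      rw [e2]
      have e3 : κ * (1 - y) - rh n / (1 + rh n) = (κ - rh n) * (1 - y) + (-rh n) * (y - rh n / (1 + rh n)) := by
        field_simp; ring
      rw [e3]
      refine (abs_add_le _ _).trans ?_
      rw [abs_mul, abs_mul, abs_neg, abs_of_pos hρ, add_comm]
      gcongr
      rw [abs_of_nonneg (by linarith : 0 ≤ 1 - y)]
      exact mul_le_of_le_one_right (abs_nonneg _) (by linarith)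
    · have := (tendsto_sub_nhds_zero_iff.2 c.ratio).comp (tendsto_add_atTop_nat 1)
      have := this.abs
      simpa using this

lemma reg_V (hn : 1 ≤ n) : Reg (gG n) (rh n) (gV n) (wv n / (wv n + 2)) 0 := by
  have hw := wv_gt hn
  have := (reg_C (ctx hn) (sq_nonneg (wv n))).mul (ctx hn) (reg_X (ctx hn))
  rw [gV_eq]
  refine this.congr ?_ (by ring)
  rw [rh]; field_simp

lemma reg_A (hn : 1 ≤ n) : Reg (gG n) (rh n) (gA n) (wv n / ((1 + wv n) * (wv n + 2))) (rh n / (1 + rh n)) := by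
  have hw := wv_gt hn
  have h := reg_B hn
  rw [gB_eq, add_comm] at h
  refine (h.sub (reg_V hn) (nn_gf _)).congr ?_ (by ring)
  field_simp; ring

lemma reg_T (hn : 1 ≤ n) : Reg (gG n) (rh n) (gT n) (wv n ^ 2 / (1 + wv n)) (1 / (1 + rh n)) := by
  have hw := wv_gt hn
  have hρ := rh_pos hn
  have h := reg_H hn
  rw [gH_eq, add_comm] at h
  refine (h.sub (reg_B hn) (nn_gf _)).congr ?_ ?_
  · field_simp; ring
  · field_simp; ring

end S17

namespace S17
open PowerSeries Filter Topology
open CC AT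

section
variable {g u v : ℝ⟦X⟧} {ρ W U V r s : ℝ}

/-- `LoS g u r`: eventually the coefficients of `u` are almost at least `r` times those of `g`. -/
def LoS (g u : ℝ⟦X⟧) (r : ℝ) : Prop := Lo (fun m => coeff m u / coeff m g) r

lemma LoS.add (h : LoS g u r) (h' : LoS g v s) : LoS g (u + v) (r + s) := by
  unfold LoS; simpa [add_div] using Lo.add h h'

lemma LoS.sum {ι : Type*} (t : Finset ι) {u : ι → ℝ⟦X⟧} {r : ι → ℝ} (h : ∀ i ∈ t, LoS g (u i) (r i)) :
    LoS g (∑ i ∈ t, u i) (∑ i ∈ t, r i) := by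
  unfold LoS
  have := Lo.sum t (fun i hi => h i hi)
  simpa [Finset.sum_div] using this

lemma LoS.of_nn (c : Ctx g ρ W) (h : Nn u) : LoS g u 0 :=
  ⟨fun _ => 0, tendsto_const_nhds, Eventually.of_forall fun m => div_nonneg (h m) (c.pos m).le⟩

lemma LoS.le (c : Ctx g ρ W) (h : LoS g u r) (hl : Le u v) (hv : Reg g ρ v V s) : r ≤ s := by
  have : Lo (fun m => coeff m v / coeff m g) r := Lo.mono h
    (Eventually.of_forall fun m => div_le_div_of_nonneg_right (hl m) (c.pos m).le)
  exact this.le_of_tendsto hv.lim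

/-- Best lower limit. -/
noncomputable def lam (g u : ℝ⟦X⟧) : ℝ := sSup {r | LoS g u r}

lemma lam_spec (c : Ctx g ρ W) (nu : Nn u) (hl : Le u v) (hv : Reg g ρ v V s) :
    LoS g u (lam g u) ∧ (∀ r', LoS g u r' → r' ≤ lam g u) ∧ 0 ≤ lam g u := by
  have bd : BddAbove {r | LoS g u r} := ⟨s, fun r hr => LoS.le c hr hl hv⟩
  have h0 : (0 : ℝ) ∈ {r | LoS g u r} := LoS.of_nn c nu
  have h2 : ∀ r', LoS g u r' → r' ≤ lam g u := fun r' h => le_csSup bd h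
  refine ⟨?_, h2, h2 0 h0⟩
  refine lo_iff.2 fun t ht => ?_
  obtain ⟨r', hr', h⟩ := exists_lt_of_lt_csSup ⟨0, h0⟩ ht
  exact lo_iff.1 hr' t h

end

variable {n : ℕ}

lemma Kp_le (c) (P : Set (BF n)) : Le (gf (Kp c P)) (gB n) := by
  rw [gB, ← gf_Kp_univ c]; exact gf_mono fun t h => ⟨h.1, trivial⟩
lemma Hp_le (c) (P : Set (BF n)) : Le (gf (Hp c P)) (gH n) := by
  rw [gH, ← gf_Hp_univ c]; exact gf_mono fun t h => ⟨h.1, trivial⟩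
lemma Tp_le (c) (P : Set (BF n)) : Le (gf (Tp c P)) (gT n) := by
  rw [gT, ← gf_Tp_univ c]; exact gf_mono fun t h => ⟨h.1, trivial⟩

lemma sum_K (c) : ∑ f : BF n, gf (Kp c {f}) = gB n := by
  classical
  rw [gB, ← gf_Kp_univ c, gf_Kp_sum]; refine Finset.sum_congr ?_ fun _ _ => rfl; ext; simp
lemma sum_H (c) : ∑ f : BF n, gf (Hp c {f}) = gH n := by
  classical
  rw [gH, ← gf_Hp_univ c, gf_Hp_sum]; refine Finset.sum_congr ?_ fun _ _ => rfl; ext; simp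

lemma Val.sum {ρ : ℝ} {ι : Type*} (s : Finset ι) {u : ι → ℝ⟦X⟧} {U : ι → ℝ} (h : ∀ i ∈ s, Val ρ (u i) (U i)) :
    Val ρ (∑ i ∈ s, u i) (∑ i ∈ s, U i) := by
  have := hasSum_sum (fun i hi => h i hi)
  simpa [Val, Finset.sum_mul] using this

def bot (n : ℕ) (c : Bool) : BF n := fun _ => !c

lemma op_bot (c) (p : BF n) : op c p (bot n c) = bot n c := by
  funext x; cases c <;> simp [op, bot]

open Classical in
lemma T_split (c) (f : BF n) : gf (Tp c {f}) = (if f = bot n c then gB n * gf (Hp c {bot n c}) else 0) +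
    ∑ pq ∈ Finset.univ.filter (fun pq : BF n × BF n => pq.2 ≠ bot n c ∧ op c pq.1 pq.2 = f),
      gf (Kp c {pq.1}) * gf (Hp c {pq.2}) := by
  rw [gf_Tp]
  rw [← Finset.sum_filter_add_sum_filter_not _ (fun pq : BF n × BF n => pq.2 = bot n c)]
  congr 1
  · rw [Finset.filter_filter]
    split_ifs with h
    · rw [← sum_K c, Finset.sum_mul]
      symm
      refine Finset.sum_bij (fun p _ => (p, bot n c)) ?_ ?_ ?_ ?_
      · intro p _; simp [op_bot, h]
      · intro p _ q _ h; simpa using h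
      · rintro ⟨p, q⟩ hpq
        simp only [Finset.mem_filter, Finset.mem_univ, true_and] at hpq
        exact ⟨p, Finset.mem_univ _, by rw [hpq.2]⟩
      · intro p _; rfl
    · apply Finset.sum_eq_zero
      rintro ⟨p, q⟩ hpq
      simp only [Finset.mem_filter, Finset.mem_univ, true_and] at hpq
      obtain ⟨h1, rfl⟩ := hpq
      rw [op_bot] at h1
      exact absurd h1.symm h
  · rw [Finset.filter_filter]
    refine Finset.sum_congr ?_ fun _ _ => rfl
    ext pq; simp only [Finset.mem_filter, Finset.mem_univ, true_and, Set.mem_singleton_iff]; tauto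

lemma bot_pos (hn : 1 ≤ n) (c) {U : ℝ} (h : Val (rh n) (gf (Hp c {bot n c})) U) : 0 < U := by
  have hρ := rh_pos hn
  have h1 : coeff 2 (gf (Hp c {bot n c})) * rh n ^ 2 ≤ U :=
    le_hasSum h 2 fun m _ => mul_nonneg (nn_gf _ _) (pow_nonneg hρ.le m)
  have h2 : 0 < coeff 2 (gf (Hp c {bot n c})) := by
    rw [coeff_gf]
    have : [AT.leaf ⟨0, hn⟩ true, AT.leaf ⟨0, hn⟩ false] ∈ {a | a ∈ Hp c {bot n c} ∧ sz a = 2} := by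
      refine ⟨⟨?_, ?_⟩, ?_⟩
      · rw [mem_H0, mem_L0_cons]
        exact ⟨mem_K0.2 (Or.inl rfl), mem_K0.2 (Or.inl rfl), nil_L0⟩
      · rw [Set.mem_singleton_iff, evalList_cons, evalList_single]
        funext x
        cases c <;> simp [op, bot, eval_leaf]
      · rw [sz_list, sizeList_cons, sizeList_cons, sizeList_nil, size_leaf, size_leaf]
    have := (Set.ncard_pos (fin_slice _ _)).2 ⟨_, this⟩
    exact_mod_cast this
  have := mul_pos h2 (pow_pos hρ 2)
  linarith

/-- The Doeblin-type minorization. -/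
lemma doeblin (hn : 1 ≤ n) (c : Bool) : ∃ κ > 0,
    wv n * (wv n + 2) * ∑ f : BF n, lam (gG n) (gf (Kp c {f})) +
      κ * (rh n / (1 + rh n) - ∑ f : BF n, lam (gG n) (gf (Kp c {f}))) ≤
        ∑ f : BF n, lam (gG n) (gf (Tp c {f})) ∧
    ∑ f : BF n, lam (gG n) (gf (Kp c {f})) + ∑ f : BF n, lam (gG n) (gf (Tp c {f})) ≤
      ∑ f : BF n, lam (gG n) (gf (Hp c {f})) := by
  classical
  have cx := ctx hn
  have hρ := rh_pos hn
  have hw := wv_gt hn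
  have lK : ∀ f : BF n, _ := fun f => lam_spec cx (nn_gf _) (Kp_le c {f}) (reg_B hn)
  have lH : ∀ f : BF n, _ := fun f => lam_spec cx (nn_gf _) (Hp_le c {f}) (reg_H hn)
  have lT : ∀ f : BF n, _ := fun f => lam_spec cx (nn_gf _) (Tp_le c {f}) (reg_T hn)
  choose b hb using fun f : BF n => Val.of_le hρ.le (nn_gf _) (Kp_le c {f}) (reg_B hn).val
  choose h hh using fun f : BF n => Val.of_le hρ.le (nn_gf _) (Hp_le c {f}) (reg_H hn).val
  have sb : ∑ f, b f = wv n / (1 + wv n) := by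
    have := Val.sum Finset.univ (fun i _ => hb i)
    rw [sum_K] at this
    exact this.unique (reg_B hn).val
  have sh : ∑ f, h f = wv n := by
    have := Val.sum Finset.univ (fun i _ => hh i)
    rw [sum_H] at this
    exact this.unique (reg_H hn).val
  set β := fun f : BF n => lam (gG n) (gf (Kp c {f})) with hβ
  set η := fun f : BF n => lam (gG n) (gf (Hp c {f})) with hη
  set τ := fun f : BF n => lam (gG n) (gf (Tp c {f})) with hτ
  have hbot := bot_pos hn c (hh (bot n c))
  have H2 : ∑ f, β f + ∑ f, τ f ≤ ∑ f, η f := by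
    rw [← Finset.sum_add_distrib]
    refine Finset.sum_le_sum fun f _ => ?_
    refine (lH f).2.1 _ ?_
    rw [gf_Hp]
    exact (lK f).1.add (lT f).1
  have H1 : ∀ f, (if f = bot n c then wv n / (1 + wv n) * η (bot n c) + h (bot n c) * (rh n / (1 + rh n)) else 0) +
      ∑ pq ∈ Finset.univ.filter (fun pq : BF n × BF n => pq.2 ≠ bot n c ∧ op c pq.1 pq.2 = f),
        (b pq.1 * η pq.2 + h pq.2 * β pq.1) ≤ τ f := by
    intro f
    refine (lT f).2.1 _ ?_
    rw [T_split]
    refine LoS.add ?_ (LoS.sum _ fun pq _ => ?_)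
    · split_ifs
      · exact lo_mul cx (nn_gf _) (nn_gf _) (reg_B hn).val (hh _) (reg_B hn).lo (lH _).1
      · exact LoS.of_nn cx (fun m => by simp)
    · exact lo_mul cx (nn_gf _) (nn_gf _) (hb _) (hh _) (lK _).1 (lH _).1
  have H3 : wv n / (1 + wv n) * η (bot n c) + h (bot n c) * (rh n / (1 + rh n)) +
      (wv n / (1 + wv n) * (∑ f, η f - η (bot n c)) + (wv n - h (bot n c)) * ∑ f, β f) ≤ ∑ f, τ f := by
    refine le_trans (le_of_eq ?_) (Finset.sum_le_sum fun f _ => H1 f)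
    rw [Finset.sum_add_distrib, Finset.sum_ite_eq' Finset.univ (bot n c), if_pos (Finset.mem_univ _)]
    congr 1
    have e1 : ∀ f : BF n, Finset.univ.filter (fun pq : BF n × BF n => pq.2 ≠ bot n c ∧ op c pq.1 pq.2 = f) =
        (Finset.univ ×ˢ Finset.univ.erase (bot n c)).filter (fun pq => op c pq.1 pq.2 = f) := by
      intro f; ext pq; simp
    simp only [e1]
    rw [Finset.sum_fiberwise, Finset.sum_product]
    simp only [Finset.sum_add_distrib, ← Finset.mul_sum, ← Finset.sum_mul]
    rw [sb, Finset.sum_erase_eq_sub (Finset.mem_univ _), Finset.sum_erase_eq_sub (Finset.mem_univ _), sh]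
  refine ⟨(1 + wv n) * h (bot n c), by positivity, ?_, H2⟩
  have w0 : 0 < wv n / (1 + wv n) := by positivity
  have H4 := mul_le_mul_of_nonneg_left H2 w0.le
  have e : 1 - wv n / (1 + wv n) = 1 / (1 + wv n) := by field_simp; ring
  have H5 : (wv n / (1 + wv n) + wv n) * ∑ f, β f + h (bot n c) * (rh n / (1 + rh n) - ∑ f, β f) ≤
      (1 / (1 + wv n)) * ∑ f, τ f := by
    rw [← e]; linarith
  have H6 := mul_le_mul_of_nonneg_left H5 (by positivity : 0 ≤ 1 + wv n)
  refine le_trans (le_of_eq ?_) (H6.trans (le_of_eq ?_))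
  · field_simp; ring
  · field_simp

lemma lam_step (hn : 1 ≤ n) (c : Bool) : rh n * ∑ f : BF n, lam (gG n) (gf (Tp (!c) {f})) ≤
    ∑ f : BF n, lam (gG n) (gf (Kp c {f})) := by
  have cx := ctx hn
  rw [Finset.mul_sum]
  refine Finset.sum_le_sum fun f _ => ?_
  refine (lam_spec cx (nn_gf _) (Kp_le c {f}) (reg_B hn)).2.1 _ ?_
  rw [gf_Kp, gf_Np]
  obtain ⟨V, hV⟩ := Val.of_le (rh_pos hn).le (nn_gf _) (Tp_le (!c) {f}) (reg_T hn).val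
  have lT := lam_spec cx (nn_gf _) (Tp_le (!c) {f}) (reg_T hn)
  have := LoS.add (LoS.of_nn cx (nn_gf (Vp {f})))
    (lo_mul cx nn_X (nn_gf _) (val_X _) hV (reg_X cx).lo lT.1)
  convert this using 1
  ring

lemma lam_K_le (hn : 1 ≤ n) (c : Bool) : ∑ f : BF n, lam (gG n) (gf (Kp c {f})) ≤ rh n / (1 + rh n) := by
  have cx := ctx hn
  refine LoS.le cx (LoS.sum Finset.univ fun f _ =>
    (lam_spec cx (nn_gf _) (Kp_le c {f}) (reg_B hn)).1) (Le.of_eq (sum_K c)) (reg_B hn)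

lemma rh_mul (hn : 1 ≤ n) : rh n * (wv n * (wv n + 2)) = 1 := by
  have := wv_gt hn
  rw [rh]; field_simp

lemma lam_K_eq (hn : 1 ≤ n) (c : Bool) : ∑ f : BF n, lam (gG n) (gf (Kp c {f})) = rh n / (1 + rh n) := by
  have step : ∀ c : Bool, ∃ κ > 0, ∑ f : BF n, lam (gG n) (gf (Kp c {f})) +
      κ * (rh n / (1 + rh n) - ∑ f : BF n, lam (gG n) (gf (Kp c {f}))) ≤
      ∑ f : BF n, lam (gG n) (gf (Kp (!c) {f})) := by
    intro c
    obtain ⟨κ, h0, h1, _⟩ := doeblin hn c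
    have h2 := lam_step hn (!c)
    rw [Bool.not_not] at h2
    have h3 := mul_le_mul_of_nonneg_left h1 (rh_pos hn).le
    have h4 := rh_mul hn
    refine ⟨rh n * κ, mul_pos (rh_pos hn) h0, ?_⟩
    rw [mul_add, ← mul_assoc, h4, one_mul, ← mul_assoc] at h3
    exact h3.trans h2
  obtain ⟨κ, h0, h1⟩ := step c
  obtain ⟨κ', h0', h1'⟩ := step (!c)
  rw [Bool.not_not] at h1'
  have a := lam_K_le hn c
  have b := lam_K_le hn (!c)
  have d : 0 ≤ κ' * (rh n / (1 + rh n) - ∑ f : BF n, lam (gG n) (gf (Kp (!c) {f}))) :=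
    mul_nonneg h0'.le (by linarith)
  have e : κ * (rh n / (1 + rh n) - ∑ f : BF n, lam (gG n) (gf (Kp c {f}))) ≤ 0 := by linarith
  have := nonpos_of_mul_nonpos_right e h0
  linarith

lemma lim_K (hn : 1 ≤ n) (c : Bool) (f : BF n) : ∃ U r, Reg (gG n) (rh n) (gf (Kp c {f})) U r := by
  have cx := ctx hn
  obtain ⟨U, hU⟩ := Val.of_le (rh_pos hn).le (nn_gf _) (Kp_le c {f}) (reg_B hn).val
  refine ⟨U, lam (gG n) (gf (Kp c {f})), nn_gf _, hU, ?_⟩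
  refine tendsto_of_lo_sum (f := fun f m => coeff m (gf (Kp c {f})) / coeff m (gG n))
    (fun f => (lam_spec cx (nn_gf _) (Kp_le c {f}) (reg_B hn)).1) ?_ (lam_K_eq hn c).ge f
  have := (reg_B hn).lim
  rw [← sum_K c] at this
  simpa [Finset.sum_div] using this

lemma lim_H (hn : 1 ≤ n) (c : Bool) (f : BF n) : ∃ U r, Reg (gG n) (rh n) (gf (Hp c {f})) U r := by
  have cx := ctx hn
  obtain ⟨U, hU⟩ := Val.of_le (rh_pos hn).le (nn_gf _) (Hp_le c {f}) (reg_H hn).val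
  refine ⟨U, lam (gG n) (gf (Hp c {f})), nn_gf _, hU, ?_⟩
  refine tendsto_of_lo_sum (f := fun f m => coeff m (gf (Hp c {f})) / coeff m (gG n)) (R := 1)
    (fun f => (lam_spec cx (nn_gf _) (Hp_le c {f}) (reg_H hn)).1) ?_ ?_ f
  · have := (reg_H hn).lim
    rw [← sum_H c] at this
    simpa [Finset.sum_div] using this
  · obtain ⟨κ, h0, h1, h2⟩ := doeblin hn c
    rw [lam_K_eq hn c] at h1 h2
    have h4 := rh_mul hn
    have h5 := rh_pos hn
    have e : wv n * (wv n + 2) * (rh n / (1 + rh n)) = 1 / (1 + rh n) := by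
      rw [← h4]; field_simp
    rw [e, sub_self, mul_zero, add_zero] at h1
    have : rh n / (1 + rh n) + 1 / (1 + rh n) = 1 := by field_simp; ring
    linarith

/-- A series is regular. -/
def IsReg (n : ℕ) (u : ℝ⟦X⟧) : Prop := ∃ U r, Reg (gG n) (rh n) u U r

lemma isReg_K (hn : 1 ≤ n) (c : Bool) (P : Set (BF n)) : IsReg n (gf (Kp c P)) := by
  choose U r h using lim_K hn c
  rw [gf_Kp_sum]
  exact ⟨_, _, Reg.sum (ctx hn) _ fun f _ => h f⟩

lemma isReg_H (hn : 1 ≤ n) (c : Bool) (P : Set (BF n)) : IsReg n (gf (Hp c P)) := by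
  choose U r h using lim_H hn c
  rw [gf_Hp_sum]
  exact ⟨_, _, Reg.sum (ctx hn) _ fun f _ => h f⟩

lemma isReg_L (hn : 1 ≤ n) (c : Bool) (P : Set (BF n)) : IsReg n (gf (Lp c P)) := by
  obtain ⟨U, r, h⟩ := isReg_H hn c P
  rw [gf_Lp]
  split_ifs
  · exact ⟨_, _, (reg_one (ctx hn)).add h⟩
  · rw [zero_add]; exact ⟨_, _, h⟩

lemma isReg_T (hn : 1 ≤ n) (c : Bool) (P : Set (BF n)) : IsReg n (gf (Tp c P)) := by
  obtain ⟨U, r, h⟩ := isReg_H hn c P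
  obtain ⟨U', r', h'⟩ := isReg_K hn c P
  rw [gf_Hp, add_comm] at h
  exact ⟨_, _, h.sub h' (nn_gf _)⟩

lemma isReg_N (hn : 1 ≤ n) (c : Bool) (P : Set (BF n)) : IsReg n (gf (Np c P)) := by
  obtain ⟨U, r, h⟩ := isReg_T hn c P
  rw [gf_Np]
  exact ⟨_, _, (reg_X (ctx hn)).mul (ctx hn) h⟩

end S17

namespace S17
open PowerSeries Filter Topology
open CC AT

variable {n : ℕ}

/-- Regular, with bounds for the value and for the limiting ratio. -/
def Bd (n : ℕ) (u : ℝ⟦X⟧) (A B : ℝ) : Prop := ∃ U r, Reg (gG n) (rh n) u U r ∧ U ≤ A ∧ r ≤ B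

section
variable {u v : ℝ⟦X⟧} {A B A' B' : ℝ}

lemma Bd.add (h : Bd n u A B) (h' : Bd n v A' B') : Bd n (u + v) (A + A') (B + B') := by
  obtain ⟨U, r, h, a, b⟩ := h
  obtain ⟨U', r', h', a', b'⟩ := h'
  exact ⟨_, _, h.add h', add_le_add a a', add_le_add b b'⟩

lemma Bd.mul (hn : 1 ≤ n) (h : Bd n u A B) (h' : Bd n v A' B') : Bd n (u * v) (A * A') (A * B' + A' * B) := by
  obtain ⟨U, r, h, a, b⟩ := h
  obtain ⟨U', r', h', a', b'⟩ := h'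
  have p := h.nonneg (ctx hn)
  have p' := h'.nonneg (ctx hn)
  refine ⟨_, _, h.mul (ctx hn) h', mul_le_mul a a' p'.1 (p.1.trans a), add_le_add ?_ ?_⟩
  · exact mul_le_mul a b' p'.2 (p.1.trans a)
  · exact mul_le_mul a' b p.2 (p'.1.trans a')

lemma Bd.mono (h : Bd n u A B) (a : A ≤ A') (b : B ≤ B') : Bd n u A' B' := by
  obtain ⟨U, r, h, c, d⟩ := h
  exact ⟨U, r, h, c.trans a, d.trans b⟩

lemma Bd.of_le (hn : 1 ≤ n) (h : IsReg n u) (hl : Le u v) (hv : Bd n v A B) : Bd n u A B := by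
  obtain ⟨U, r, h⟩ := h
  obtain ⟨U', r', h', a', b'⟩ := hv
  have := h.le (ctx hn) h' hl
  exact ⟨U, r, h, this.1.trans a', this.2.trans b'⟩

lemma Bd.pow (hn : 1 ≤ n) (h : Bd n u A B) (k : ℕ) : Bd n (u ^ (k + 1)) (A ^ (k + 1)) ((k + 1) * A ^ k * B) := by
  induction k with
  | zero => simpa using h
  | succ k ih =>
    rw [pow_succ u]
    refine (ih.mul hn h).mono (by rw [pow_succ A (k + 1)]) (le_of_eq ?_)
    push_cast; ring

end

lemma bd_X (hn : 1 ≤ n) : Bd n X (1 / wv n ^ 2) 0 := by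
  have := wv_gt hn
  refine ⟨_, _, reg_X (ctx hn), ?_, le_rfl⟩
  rw [rh]; gcongr; nlinarith

lemma bd_G (hn : 1 ≤ n) : Bd n (gG n) (2 * wv n) 1 := by
  have := wv_gt hn
  exact ⟨_, _, (ctx hn).reg, by linarith, le_rfl⟩

lemma bd_V (hn : 1 ≤ n) : Bd n (gV n) 1 0 := by
  have := wv_gt hn
  refine ⟨_, _, reg_V hn, ?_, le_rfl⟩
  rw [div_le_one (by linarith)]; linarith

lemma bd_A (hn : 1 ≤ n) : Bd n (gA n) (1 / wv n) (1 / wv n ^ 2) := by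
  have := wv_gt hn
  have h := rh_pos hn
  refine ⟨_, _, reg_A hn, ?_, ?_⟩
  · rw [div_le_div_iff₀ (by positivity) (by positivity)]; nlinarith
  · refine (div_le_self h.le (by linarith)).trans ?_
    rw [rh]; gcongr; nlinarith

lemma gf_L0 (c) : gf (L0 n c) = gG n := by
  rw [← gL_eq c]; congr 1; ext; simp [Lp]

lemma gf_N0 (c) : gf (N0 n c) = gA n := by
  rw [gA, ← gf_Np_univ c]; congr 1; ext; simp [Np]

/-- functions implying the literal `x` -/
def Plx (x : Fin n) : Set (BF n) := {f | ∀ y, f y = true → y x = true}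
def ff (n : ℕ) : BF n := fun _ => false
def tt (n : ℕ) : BF n := fun _ => true
def lit (x : Fin n) : BF n := fun y => y x
/-- functions implying `x`, not constant -/
def PM (x : Fin n) : Set (BF n) := {f | f ∈ Plx x ∧ f ≠ ff n}

def neg : AT n → AT n
  | .leaf i b => .leaf i (!b)
  | t => t

lemma size_neg (t : AT n) : size (neg t) = size t := by
  cases t <;> simp [neg, size_leaf]

lemma two_mem {α : Type*} {l : List α} {a b : α} (ha : a ∈ l) (hb : b ∈ l) (hab : a ≠ b) :
    (∃ l1 l2 l3, l = l1 ++ a :: (l2 ++ b :: l3)) ∨ (∃ l1 l2 l3, l = l1 ++ b :: (l2 ++ a :: l3)) := by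
  obtain ⟨l1, l2, rfl⟩ := List.append_of_mem ha
  rcases List.mem_append.1 hb with h | h
  · obtain ⟨l3, l4, rfl⟩ := List.append_of_mem h
    right; exact ⟨l3, l4, l2, by simp⟩
  · rcases List.mem_cons.1 h with h | h
    · exact absurd h.symm hab
    · obtain ⟨l3, l4, rfl⟩ := List.append_of_mem h
      left; exact ⟨l1, l3, l4, rfl⟩

/-- The structural dichotomy for conjunctions implying `x`. -/
lemma M_struct (x : Fin n) {ts : List (AT n)} (hts : ts ∈ T0 n true) (h : evalList true ts ∈ PM x) :
    AT.leaf x true ∈ ts ∨ (∃ t0 l0, AT.node false (t0 :: l0) ∈ ts ∧ t0 ∈ N0 n true) ∨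
    (∃ i b l0, AT.leaf i b ∈ ts ∧ AT.node false (.leaf i (!b) :: l0) ∈ ts) ∨
    (∃ l0, AT.node false (.leaf x true :: l0) ∈ ts) ∨
    (∃ i b l0 l0', AT.node false (.leaf i b :: l0) ∈ ts ∧ AT.node false (.leaf i (!b) :: l0') ∈ ts) := by
  classical
  by_contra! hc
  obtain ⟨h1, h2, h3, h4, h5⟩ := hc
  set y : Fin n → Bool := fun i => decide (AT.leaf i true ∈ ts ∨ ∃ l0, AT.node false (.leaf i true :: l0) ∈ ts) with hy
  have hs : evalList true ts y = true := by
    rw [evalList_true]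
    intro t ht
    rcases mem_K0.1 (hts.1 t ht) with hv | hN
    · obtain ⟨i, b, rfl⟩ := mem_V0.1 hv
      rw [eval_leaf]
      cases b with
      | true => simp only [if_true, hy, decide_eq_true_eq]; exact Or.inl ht
      | false =>
        simp only [Bool.false_eq_true, if_false, hy, Bool.not_eq_true', decide_eq_false_iff_not]
        rintro (h' | ⟨l0, h'⟩)
        · refine h.2 (funext fun z => ?_)
          rw [ff, ← Bool.not_eq_true, evalList_true]
          intro hz
          have a := hz _ ht
          have b := hz _ h'
          simp [eval_leaf] at a b
          rw [a] at b; simp at b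
        · exact h3 i false l0 ht h'
    · obtain ⟨ts', hts', rfl⟩ := mem_N0.1 hN
      rw [eval_node]
      simp only [Bool.not_true] at *
      cases ts' with
      | nil => have := hts'.2; simp at this
      | cons s l =>
        rw [evalList_false]
        refine ⟨s, by simp, ?_⟩
        rcases mem_K0.1 (mem_T0.1 hts').1 with hv | hN'
        · obtain ⟨i, b, rfl⟩ := mem_V0.1 hv
          rw [eval_leaf]
          cases b with
          | true => simp only [if_true, hy, decide_eq_true_eq]; exact Or.inr ⟨l, ht⟩
          | false =>
            simp only [Bool.false_eq_true, if_false, hy, Bool.not_eq_true', decide_eq_false_iff_not]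
            rintro (h' | ⟨l0, h'⟩)
            · exact h3 i true l h' ht
            · exact h5 i false l l0 ht h'
        · exact absurd hN' (h2 s l ht)
  have := h.1 y hs
  simp only [hy, decide_eq_true_eq] at this
  rcases this with h' | ⟨l0, h'⟩
  · exact h1 h'
  · exact h4 l0 h'

/-- The bounding series for `M`. -/
noncomputable def gMb (n : ℕ) : ℝ⟦X⟧ :=
  X ^ 2 * (gG n * gG n) + (X ^ 2 * (gA n * (gG n * (gG n * gG n))) +
   (X ^ 3 * (gV n * (gG n * (gG n * (gG n * gG n)))) + (X ^ 3 * (gV n * (gG n * (gG n * (gG n * gG n)))) +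
    (X ^ 3 * (gG n * (gG n * gG n)) +
      X ^ 4 * (gV n * (gG n * (gG n * (gG n * (gG n * gG n)))))))))

lemma child_K {c : Bool} {ts : List (AT n)} (hts : ts ∈ L0 n c) {s : AT n} {l : List (AT n)}
    (h : AT.node (!c) (s :: l) ∈ ts) : l ∈ L0 n (!c) := by
  have := (hts _ h).1
  rw [wf_node, mem_T0] at this
  exact this.2.1

lemma gf_img {α β : Type*} [CC α] [CC β] {S : Set α} {f : α → β} {k : ℕ} {u : ℝ⟦X⟧}
    (h : ∀ a ∈ S, sz (f a) = sz a + k) (e : gf S = u) : Le (gf (f '' S)) (X ^ k * u) := by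
  subst e
  exact gf_cover f k h fun b ⟨a, ha, e⟩ => ⟨a, ha, e⟩

lemma M_le (x : Fin n) : Le (gf (Np true (PM x))) (gMb n) := by
  have hsub : Np true (PM x) ⊆
      (fun a : List (AT n) × List (AT n) => AT.node true (a.1 ++ .leaf x true :: a.2)) '' (L0 n true ×ˢ L0 n true) ∪
      ((fun a : AT n × List (AT n) × List (AT n) × List (AT n) =>
        AT.node true (a.2.1 ++ .node false (a.1 :: a.2.2.1) :: a.2.2.2)) ''
          (N0 n true ×ˢ (L0 n true ×ˢ (L0 n false ×ˢ L0 n true))) ∪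
      ((fun a : AT n × List (AT n) × List (AT n) × List (AT n) × List (AT n) =>
        AT.node true (a.2.1 ++ a.1 :: (a.2.2.1 ++ .node false (neg a.1 :: a.2.2.2.1) :: a.2.2.2.2))) ''
          (V0 n ×ˢ (L0 n true ×ˢ (L0 n true ×ˢ (L0 n false ×ˢ L0 n true)))) ∪
      ((fun a : AT n × List (AT n) × List (AT n) × List (AT n) × List (AT n) =>
        AT.node true (a.2.1 ++ .node false (neg a.1 :: a.2.2.2.1) :: (a.2.2.1 ++ a.1 :: a.2.2.2.2))) ''
          (V0 n ×ˢ (L0 n true ×ˢ (L0 n true ×ˢ (L0 n false ×ˢ L0 n true)))) ∪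
      ((fun a : List (AT n) × List (AT n) × List (AT n) =>
        AT.node true (a.1 ++ .node false (.leaf x true :: a.2.1) :: a.2.2)) ''
          (L0 n true ×ˢ (L0 n false ×ˢ L0 n true)) ∪
      (fun a : AT n × List (AT n) × List (AT n) × List (AT n) × List (AT n) × List (AT n) =>
        AT.node true (a.2.1 ++ .node false (a.1 :: a.2.2.1) :: (a.2.2.2.1 ++
          .node false (neg a.1 :: a.2.2.2.2.1) :: a.2.2.2.2.2))) ''
          (V0 n ×ˢ (L0 n true ×ˢ (L0 n false ×ˢ (L0 n true ×ˢ (L0 n false ×ˢ L0 n true))))))))) := by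
    rintro t ⟨h1, h2⟩
    obtain ⟨ts, hts, rfl⟩ := mem_N0.1 h1
    rw [eval_node] at h2
    have hL := hts.1
    rcases M_struct x hts h2 with h | ⟨t0, l0, h, h0⟩ | ⟨i, b, l0, h, h'⟩ | ⟨l0, h⟩ | ⟨i, b, l0, l0', h, h'⟩
    · obtain ⟨l1, l2, rfl⟩ := List.append_of_mem h
      rw [mem_L0_append, mem_L0_cons] at hL
      exact Or.inl ⟨(l1, l2), ⟨hL.1, hL.2.2⟩, rfl⟩
    · have hl0 := child_K hL h
      obtain ⟨l1, l2, rfl⟩ := List.append_of_mem h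
      rw [mem_L0_append, mem_L0_cons] at hL
      exact Or.inr (Or.inl ⟨(t0, l1, l0, l2), ⟨h0, hL.1, hl0, hL.2.2⟩, rfl⟩)
    · have hl0 := child_K hL h'
      rcases two_mem h h' (by simp) with ⟨l1, l2, l3, rfl⟩ | ⟨l1, l2, l3, rfl⟩
      · rw [mem_L0_append, mem_L0_cons, mem_L0_append, mem_L0_cons] at hL
        exact Or.inr (Or.inr (Or.inl ⟨(.leaf i b, l1, l2, l0, l3), ⟨rfl, hL.1, hL.2.2.1, hl0, hL.2.2.2.2⟩, rfl⟩))
      · rw [mem_L0_append, mem_L0_cons, mem_L0_append, mem_L0_cons] at hL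
        exact Or.inr (Or.inr (Or.inr (Or.inl
          ⟨(.leaf i b, l1, l2, l0, l3), ⟨rfl, hL.1, hL.2.2.1, hl0, hL.2.2.2.2⟩, rfl⟩)))
    · have hl0 := child_K hL h
      obtain ⟨l1, l2, rfl⟩ := List.append_of_mem h
      rw [mem_L0_append, mem_L0_cons] at hL
      exact Or.inr (Or.inr (Or.inr (Or.inr (Or.inl ⟨(l1, l0, l2), ⟨hL.1, hl0, hL.2.2⟩, rfl⟩))))
    · have hl0 := child_K hL h
      have hl0' := child_K hL h'
      rcases two_mem h h' (by cases b <;> simp) with ⟨l1, l2, l3, rfl⟩ | ⟨l1, l2, l3, rfl⟩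
      · rw [mem_L0_append, mem_L0_cons, mem_L0_append, mem_L0_cons] at hL
        exact Or.inr (Or.inr (Or.inr (Or.inr (Or.inr
          ⟨(.leaf i b, l1, l0, l2, l0', l3), ⟨rfl, hL.1, hl0, hL.2.2.1, hl0', hL.2.2.2.2⟩, rfl⟩))))
      · rw [mem_L0_append, mem_L0_cons, mem_L0_append, mem_L0_cons] at hL
        exact Or.inr (Or.inr (Or.inr (Or.inr (Or.inr
          ⟨(.leaf i (!b), l1, l0', l2, l0, l3), ⟨rfl, hL.1, hl0', hL.2.2.1, hl0, hL.2.2.2.2⟩, by simp [neg]⟩))))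
  refine (gf_mono hsub).trans ((gf_union_le _ _).trans (Le.add ?_ ((gf_union_le _ _).trans (Le.add ?_
    ((gf_union_le _ _).trans (Le.add ?_ ((gf_union_le _ _).trans (Le.add ?_ ((gf_union_le _ _).trans (Le.add ?_ ?_))))))))))
  all_goals
    refine gf_img ?_ ?_
    rotate_left
    · simp only [gf_prod, gf_L0, gf_N0, gV]
  · rintro ⟨a, b⟩ -
    simp only [sz_at, sz_prod, sz_list, size_node, sizeList_append, sizeList_cons, size_leaf]; omega
  · rintro ⟨a, b, c, d⟩ -
    simp only [sz_at, sz_prod, sz_list, size_node, sizeList_append, sizeList_cons, size_leaf]; omega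
  · rintro ⟨a, b, c, d, e⟩ ⟨ha, -⟩
    obtain ⟨i, b', h⟩ := mem_V0.1 ha
    simp only at h
    subst h
    simp only [sz_at, sz_prod, sz_list, size_node, sizeList_append, sizeList_cons, size_leaf, size_neg]; omega
  · rintro ⟨a, b, c, d, e⟩ ⟨ha, -⟩
    obtain ⟨i, b', h⟩ := mem_V0.1 ha
    simp only at h
    subst h
    simp only [sz_at, sz_prod, sz_list, size_node, sizeList_append, sizeList_cons, size_leaf, size_neg]; omega
  · rintro ⟨a, b, c⟩ -
    simp only [sz_at, sz_prod, sz_list, size_node, sizeList_append, sizeList_cons, size_leaf]; omega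
  · rintro ⟨a, b, c, d, e, f⟩ ⟨ha, -⟩
    obtain ⟨i, b', h⟩ := mem_V0.1 ha
    simp only at h
    subst h
    simp only [sz_at, sz_prod, sz_list, size_node, sizeList_append, sizeList_cons, size_leaf, size_neg]; omega

end S17

namespace S17
open PowerSeries Filter Topology
open CC AT

variable {n : ℕ}

lemma leaf_Plx {x i : Fin n} {b : Bool} (h : eval (AT.leaf i b) ∈ Plx x) : i = x ∧ b = true := by
  have := h (fun j => if j = i then b else false)
  rw [eval_leaf] at this
  simp only [if_true] at this
  have h1 := this (by cases b <;> simp)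
  by_cases e : x = i
  · rw [if_pos e] at h1; exact ⟨e.symm, h1⟩
  · rw [if_neg e] at h1; simp at h1

lemma K_cases {x : Fin n} {t : AT n} (h : t ∈ Kp false (Plx x)) :
    t = .leaf x true ∨ (t ∈ Np true (Plx x)) := by
  obtain ⟨h1, h2⟩ := h
  rcases mem_K0.1 h1 with h | h
  · obtain ⟨i, b, rfl⟩ := mem_V0.1 h
    obtain ⟨rfl, rfl⟩ := leaf_Plx h2
    left; rfl
  · exact Or.inr ⟨h, h2⟩

lemma leaf_mem_Kp (x : Fin n) : AT.leaf x true ∈ Kp false (Plx x) :=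
  ⟨mem_K0.2 (Or.inl rfl), fun y h => by simpa [eval_leaf] using h⟩

lemma y_le (x : Fin n) : Le (gf (Kp false (Plx x))) (X + gA n) := by
  have : Kp false (Plx x) ⊆ {AT.leaf x true} ∪ N0 n true := by
    intro t h
    rcases K_cases h with h | h
    · exact Or.inl h
    · exact Or.inr h.1
  refine (gf_mono this).trans ((gf_union_le _ _).trans (Le.add (Le.of_eq ?_) (Le.of_eq (gf_N0 _))))
  rw [gf_singleton, sz_at, size_leaf, pow_one]

lemma mem_LP {x : Fin n} {ts : List (AT n)} : ts ∈ Lp false (Plx x) ↔ ∀ t ∈ ts, t ∈ Kp false (Plx x) := by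
  constructor
  · rintro ⟨h1, h2⟩ t ht
    exact ⟨h1 t ht, fun y hy => h2 y ((evalList_false _ _).2 ⟨t, ht, hy⟩)⟩
  · intro h
    refine ⟨fun t ht => (h t ht).1, fun y hy => ?_⟩
    obtain ⟨t, ht, hy⟩ := (evalList_false _ _).1 hy
    exact (h t ht).2 y hy

lemma LP_append {x : Fin n} {l l' : List (AT n)} : l ++ l' ∈ Lp false (Plx x) ↔
    l ∈ Lp false (Plx x) ∧ l' ∈ Lp false (Plx x) := by
  simp only [mem_LP, List.mem_append]
  constructor
  · exact fun h => ⟨fun t ht => h t (Or.inl ht), fun t ht => h t (Or.inr ht)⟩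
  · rintro ⟨h1, h2⟩ t (ht | ht)
    exacts [h1 t ht, h2 t ht]

lemma LP_cons {x : Fin n} {t} {l : List (AT n)} : t :: l ∈ Lp false (Plx x) ↔
    t ∈ Kp false (Plx x) ∧ l ∈ Lp false (Plx x) := by
  simp only [mem_LP, List.mem_cons]
  constructor
  · exact fun h => ⟨h _ (Or.inl rfl), fun t ht => h t (Or.inr ht)⟩
  · rintro ⟨h1, h2⟩ t (rfl | ht)
    exacts [h1, h2 t ht]

lemma Y_eq (x : Fin n) : gf (Lp false (Plx x)) = 1 + gf (Kp false (Plx x)) * gf (Lp false (Plx x)) := by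
  rw [← gf_prod]
  conv_lhs => rw [gf_Lp]
  congr 1
  · rw [if_pos]; intro y h; simp at h
  · rw [← one_mul (gf (_ ×ˢ _)), ← pow_zero X]
    refine gf_bij (fun a => a.1 :: a.2) 0 ?_ ?_ ?_ ?_
    · intro a _; rw [sz_list, sizeList_cons]; rfl
    · rintro ⟨t, ts⟩ ⟨h1, h2⟩
      have := LP_cons.2 ⟨h1, h2⟩
      exact ⟨⟨this.1, by simp⟩, this.2⟩
    · rintro ⟨t, ts⟩ _ ⟨t', ts'⟩ _ h
      simpa using h
    · rintro l ⟨h1, h2⟩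
      cases l with
      | nil => exact absurd rfl h1.2
      | cons t ts =>
        have := LP_cons.1 (⟨h1.1, h2⟩ : t :: ts ∈ Lp false (Plx x))
        exact ⟨(t, ts), this, rfl⟩

/-- Names for the series. -/
noncomputable def sM (x : Fin n) : ℝ⟦X⟧ := gf (Np true (PM x))
noncomputable def sy (x : Fin n) : ℝ⟦X⟧ := gf (Kp false (Plx x))
noncomputable def sY (x : Fin n) : ℝ⟦X⟧ := gf (Lp false (Plx x))
noncomputable def sF (n : ℕ) : ℝ⟦X⟧ := gf (Np true {ff n})
noncomputable def sx (x : Fin n) : ℝ⟦X⟧ := gf (Np true {lit x})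

lemma df_lit (x : Fin n) : df (lit x) = lit x := by funext y; simp [df, lit]

lemma sx_dual (x : Fin n) : gf (Np false {lit x}) = sx x := by
  have := gf_dual true {lit x}
  rw [Bool.not_true] at this
  rw [this, sx]
  congr 2
  ext f
  simp only [Set.mem_preimage, Set.mem_singleton_iff]
  constructor
  · intro h; rw [← df_df f, h, df_lit]
  · rintro rfl; exact df_lit x

noncomputable def sxb (x : Fin n) : ℝ⟦X⟧ :=
  X ^ 2 * sF n + (X ^ 2 * sF n + (X ^ 3 + (X ^ 2 * sM x + (X ^ 2 * sM x +
   (X ^ 2 * (sy x * (sy x * (sY x * sY x))) + (X ^ 2 * (sy x * (sy x * (sY x * sY x))) +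
    (X ^ 2 * (sy x * (sy x * (sY x * sY x))) + (X ^ 1 * (sx x * (sy x * (sY x * sY x))) +
     (X ^ 1 * (sx x * (sy x * (sY x * sY x))) + X ^ 1 * (sM x * (sM x * (sY x * (sY x * sY x)))))))))))))

lemma Np_lit_le_PM (x : Fin n) : Np true {lit x} ⊆ Np true (PM x) := by
  rintro t ⟨h1, h2⟩
  refine ⟨h1, ?_, ?_⟩
  · rw [h2]; exact fun y h => h
  · rw [h2]; intro h; have := congrFun h (fun _ => true); simp [lit, ff] at this

lemma sx_le (x : Fin n) : Le (sx x) (sxb x) := by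
  rw [← sx_dual]
  set v : AT n := .leaf x true with hv
  set y := Kp false (Plx x) with hy
  set Y := Lp false (Plx x) with hY
  set M := Np true (PM x) with hM
  have hsub : Np false {lit x} ⊆
      (fun s : AT n => AT.node false [v, s]) '' (Np true {ff n}) ∪
      ((fun s : AT n => AT.node false [s, v]) '' (Np true {ff n}) ∪
      ({AT.node false [v, v]} ∪
      ((fun s : AT n => AT.node false [v, s]) '' M ∪
      ((fun s : AT n => AT.node false [s, v]) '' M ∪
      ((fun a : AT n × AT n × List (AT n) × List (AT n) =>
        AT.node false (a.1 :: a.2.1 :: a.2.2.1 ++ v :: a.2.2.2)) '' (y ×ˢ (y ×ˢ (Y ×ˢ Y))) ∪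
      ((fun a : AT n × AT n × List (AT n) × List (AT n) =>
        AT.node false (a.1 :: a.2.2.1 ++ v :: a.2.1 :: a.2.2.2)) '' (y ×ˢ (y ×ˢ (Y ×ˢ Y))) ∪
      ((fun a : AT n × AT n × List (AT n) × List (AT n) =>
        AT.node false (a.2.2.1 ++ v :: a.1 :: a.2.1 :: a.2.2.2)) '' (y ×ˢ (y ×ˢ (Y ×ˢ Y))) ∪
      ((fun a : AT n × AT n × List (AT n) × List (AT n) =>
        AT.node false (a.2.1 :: a.2.2.1 ++ a.1 :: a.2.2.2)) '' (Np true {lit x} ×ˢ (y ×ˢ (Y ×ˢ Y))) ∪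
      ((fun a : AT n × AT n × List (AT n) × List (AT n) =>
        AT.node false (a.2.2.1 ++ a.1 :: a.2.1 :: a.2.2.2)) '' (Np true {lit x} ×ˢ (y ×ˢ (Y ×ˢ Y))) ∪
      (fun a : AT n × AT n × List (AT n) × List (AT n) × List (AT n) =>
        AT.node false (a.2.2.1 ++ a.1 :: (a.2.2.2.1 ++ a.2.1 :: a.2.2.2.2))) ''
          (M ×ˢ (M ×ˢ (Y ×ˢ (Y ×ˢ Y))))))))))))) := by
    rintro t ⟨h1, h2⟩
    obtain ⟨ts, hts, rfl⟩ := mem_N0.1 h1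
    rw [eval_node, Set.mem_singleton_iff] at h2
    have hL : ts ∈ Y := ⟨hts.1, by rw [h2]; exact fun y h => h⟩
    have hlen := hts.2
    have cls : ∀ s ∈ y, s = v ∨ s ∈ Np true {ff n} ∨ s ∈ M := by
      intro s hs
      rcases K_cases hs with h | h
      · exact Or.inl h
      · by_cases e : eval s = ff n
        · exact Or.inr (Or.inl ⟨h.1, e⟩)
        · exact Or.inr (Or.inr ⟨h.1, h.2, e⟩)
    by_cases hx : v ∈ ts
    · obtain ⟨l1, l2, rfl⟩ := List.append_of_mem hx
      rw [hY, LP_append, LP_cons] at hL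
      obtain ⟨m1, _, m2⟩ := hL
      rcases l1 with _ | ⟨a, _ | ⟨b, l1⟩⟩
      · rcases l2 with _ | ⟨a, _ | ⟨b, l2⟩⟩
        · simp at hlen
        · rw [LP_cons] at m2
          rcases cls a m2.1 with rfl | h | h
          · exact Or.inr (Or.inr (Or.inl rfl))
          · exact Or.inl ⟨a, h, rfl⟩
          · exact Or.inr (Or.inr (Or.inr (Or.inl ⟨a, h, rfl⟩)))
        · rw [LP_cons, LP_cons] at m2
          iterate 7 right
          left
          exact ⟨(a, b, [], l2), ⟨m2.1, m2.2.1, m1, m2.2.2⟩, rfl⟩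
      · rw [LP_cons] at m1
        rcases l2 with _ | ⟨b, l2⟩
        · rcases cls a m1.1 with rfl | h | h
          · exact Or.inr (Or.inr (Or.inl rfl))
          · exact Or.inr (Or.inl ⟨a, h, rfl⟩)
          · exact Or.inr (Or.inr (Or.inr (Or.inr (Or.inl ⟨a, h, rfl⟩))))
        · rw [LP_cons] at m2
          iterate 6 right
          left
          exact ⟨(a, b, [], l2), ⟨m1.1, m2.1, m1.2, m2.2⟩, rfl⟩
      · rw [LP_cons, LP_cons] at m1
        iterate 5 right
        left
        exact ⟨(a, b, l1, l2), ⟨m1.1, m1.2.1, m1.2.2, m2⟩, rfl⟩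
    · have nv : ∀ s ∈ ts, s ∈ Np true {ff n} ∨ s ∈ M := by
        intro s hs
        rcases cls s (mem_LP.1 hL s hs) with rfl | h | h
        · exact absurd hs hx
        · exact Or.inl h
        · exact Or.inr h
      by_cases hs : ∃ s ∈ ts, eval s = lit x
      · obtain ⟨s, hs, es⟩ := hs
        have sN : s ∈ Np true {lit x} := by
          rcases nv s hs with h | h
          · exact ⟨h.1, es⟩
          · exact ⟨h.1, es⟩
        obtain ⟨l1, l2, rfl⟩ := List.append_of_mem hs
        rw [hY, LP_append, LP_cons] at hL
        obtain ⟨m1, _, m2⟩ := hL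
        rcases l1 with _ | ⟨a, l1⟩
        · rcases l2 with _ | ⟨a, l2⟩
          · simp at hlen
          · rw [LP_cons] at m2
            iterate 9 right
            left
            exact ⟨(s, a, [], l2), ⟨sN, m2.1, m1, m2.2⟩, rfl⟩
        · rw [LP_cons] at m1
          iterate 8 right
          left
          exact ⟨(s, a, l1, l2), ⟨sN, m1.1, m1.2, m2⟩, rfl⟩
      · iterate 10 right
        push Not at hs
        have h3 : evalList false ts (fun _ => true) = true := by rw [h2]; rfl
        obtain ⟨s, hst, es⟩ := (evalList_false _ _).1 h3
        have mem : ∀ s ∈ ts, eval s ≠ ff n → s ∈ M := by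
          intro s h h'
          rcases nv s h with h'' | h''
          · exact absurd h''.2 h'
          · exact h''
        have sM : s ∈ M := mem s hst fun h => by rw [h] at es; simp [ff] at es
        obtain ⟨l1, l2, e⟩ := List.append_of_mem hst
        have : ∃ s', s' ∈ l1 ++ l2 ∧ eval s' ≠ ff n := by
          by_contra! hc
          refine hs s hst (funext fun z => ?_)
          rw [Bool.eq_iff_iff]
          refine ⟨fun h => sM.2.1 z h, fun h => ?_⟩
          have h4 : evalList false ts z = true := by rw [h2]; exact h
          obtain ⟨t, ht, et⟩ := (evalList_false _ _).1 h4
          rw [e] at ht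
          by_cases hts : t = s
          · rw [← hts]; exact et
          · have : t ∈ l1 ++ l2 := by
              simp only [List.mem_append, List.mem_cons] at ht ⊢
              tauto
            rw [hc t this] at et
            simp [ff] at et
        obtain ⟨s', h5, h6⟩ := this
        have s'M : s' ∈ M := by
          refine mem s' ?_ h6
          rw [e]; simp only [List.mem_append, List.mem_cons] at h5 ⊢; tauto
        subst e
        rcases List.mem_append.1 h5 with h | h
        · obtain ⟨l3, l4, rfl⟩ := List.append_of_mem h
          rw [hY, LP_append, LP_append, LP_cons, LP_cons] at hL
          exact ⟨(s', s, l3, l4, l2), ⟨s'M, sM, hL.1.1, hL.1.2.2, hL.2.2⟩, by simp⟩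
        · obtain ⟨l3, l4, rfl⟩ := List.append_of_mem h
          rw [hY, LP_append, LP_cons, LP_append, LP_cons] at hL
          exact ⟨(s, s', l1, l3, l4), ⟨sM, s'M, hL.1, hL.2.2.1, hL.2.2.2.2⟩, rfl⟩
  have lf : size v = 1 := size_leaf _ _
  refine (gf_mono hsub).trans ?_
  refine (gf_union_le _ _).trans (Le.add (gf_img ?_ rfl) ?_)
  · intro s _; simp only [sz_at, size_node, sizeList_cons, sizeList_nil, lf]; omega
  refine (gf_union_le _ _).trans (Le.add (gf_img ?_ rfl) ?_)
  · intro s _; simp only [sz_at, size_node, sizeList_cons, sizeList_nil, lf]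
  refine (gf_union_le _ _).trans (Le.add ?_ ?_)
  · rw [gf_singleton, sz_at, size_node, sizeList_cons, sizeList_cons, sizeList_nil, lf]; exact Le.refl _
  refine (gf_union_le _ _).trans (Le.add (gf_img ?_ rfl) ?_)
  · intro s _; simp only [sz_at, size_node, sizeList_cons, sizeList_nil, lf]; omega
  refine (gf_union_le _ _).trans (Le.add (gf_img ?_ rfl) ?_)
  · intro s _; simp only [sz_at, size_node, sizeList_cons, sizeList_nil, lf]
  iterate 5
    refine (gf_union_le _ _).trans (Le.add (gf_img ?_ ?_) ?_)
    · rintro ⟨a, b, c, d⟩ -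
      simp only [sz_at, sz_prod, sz_list, size_node, sizeList_append, sizeList_cons, lf, List.cons_append]; omega
    · simp only [gf_prod]; rfl
  refine gf_img ?_ ?_
  · rintro ⟨a, b, c, d, e⟩ -
    simp only [sz_at, sz_prod, sz_list, size_node, sizeList_append, sizeList_cons, lf]; omega
  · simp only [gf_prod]; rfl

end S17

namespace S17
open PowerSeries Filter Topology
open CC AT

variable {n : ℕ}

/-- The small parameter `1/√(2n)`. -/
noncomputable def ti (n : ℕ) : ℝ := 1 / wv n

lemma ti_pos (hn : 1 ≤ n) : 0 < ti n := by
  have := wv_gt hn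
  rw [ti]; positivity

lemma bd_X' (hn : 1 ≤ n) : Bd n X (rh n) 0 := ⟨_, _, reg_X (ctx hn), le_rfl, le_rfl⟩

lemma rh_le_ti (hn : 1 ≤ n) : rh n ≤ ti n ^ 2 := by
  have := wv_gt hn
  rw [rh, ti, div_pow, one_pow]; gcongr; nlinarith

lemma bd_Xp (hn : 1 ≤ n) (k : ℕ) : Bd n (X ^ (k + 1)) (ti n ^ (2 * (k + 1))) 0 := by
  refine ((bd_X' hn).pow hn k).mono ?_ (by simp)
  rw [pow_mul]
  exact pow_le_pow_left₀ (rh_pos hn).le (rh_le_ti hn) _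

lemma bd_M (hn : 1 ≤ n) (ht : ti n ≤ 1 / 4) (x : Fin n) : Bd n (sM x) (84 * ti n ^ 2) (180 * ti n ^ 3) := by
  refine Bd.of_le hn (isReg_N hn _ _) (M_le x) ?_
  have t0 := ti_pos hn
  have hwt : wv n = 1 / ti n := by rw [ti, one_div_one_div]
  have G1 : Bd n (gG n) (2 / ti n) 1 := by
    have := bd_G hn; rw [hwt] at this; simpa [div_eq_mul_inv] using this
  have A1 : Bd n (gA n) (ti n) (ti n ^ 2) := by
    have := bd_A hn; rw [hwt] at this; simpa [div_eq_mul_inv] using this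
  have V1 := bd_V hn
  have G2 := G1.mul hn G1
  have G3 := G1.mul hn G2
  have G4 := G1.mul hn G3
  have G5 := G1.mul hn G4
  have e1 := (bd_Xp hn 1).mul hn G2
  have e2 := (bd_Xp hn 1).mul hn (A1.mul hn G3)
  have e3 := (bd_Xp hn 2).mul hn (V1.mul hn G4)
  have e5 := (bd_Xp hn 2).mul hn G3
  have e6 := (bd_Xp hn 3).mul hn (V1.mul hn G5)
  rw [gMb]
  refine (e1.add (e2.add (e3.add (e3.add (e5.add e6))))).mono ?_ ?_
  · generalize ti n = t at *
    have m1 : t ^ 8 ≤ t ^ 7 := pow_le_pow_of_le_one t0.le (by linarith) (by norm_num)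
    have m2 : t ^ 9 ≤ t ^ 8 := pow_le_pow_of_le_one t0.le (by linarith) (by norm_num)
    have m3 : t ^ 10 ≤ t ^ 9 := pow_le_pow_of_le_one t0.le (by linarith) (by norm_num)
    field_simp
    ring_nf
    nlinarith
  · generalize ti n = t at *
    have m1 : t ^ 8 ≤ t ^ 7 := pow_le_pow_of_le_one t0.le (by linarith) (by norm_num)
    have m2 : t ^ 9 ≤ t ^ 8 := pow_le_pow_of_le_one t0.le (by linarith) (by norm_num)
    have m3 : t ^ 10 ≤ t ^ 9 := pow_le_pow_of_le_one t0.le (by linarith) (by norm_num)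
    field_simp
    ring_nf
    nlinarith

lemma bd_y (hn : 1 ≤ n) (ht : ti n ≤ 1 / 4) (x : Fin n) : Bd n (sy x) (2 * ti n) (ti n ^ 2) := by
  refine Bd.of_le hn (isReg_K hn _ _) (y_le x) ?_
  have t0 := ti_pos hn
  have A1 := bd_A hn
  have X1 := bd_Xp hn 0
  rw [zero_add, pow_one, mul_one] at X1
  refine (X1.add A1).mono ?_ ?_
  · rw [← ti]; nlinarith
  · rw [ti, div_pow]; simp

lemma bd_Y (hn : 1 ≤ n) (ht : ti n ≤ 1 / 4) (x : Fin n) : Bd n (sY x) 2 (4 * ti n ^ 2) := by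
  have t0 := ti_pos hn
  obtain ⟨U, r, hY⟩ := isReg_L hn false (Plx x)
  obtain ⟨a, b, hy, ha, hb⟩ := bd_y hn ht x
  have h2 := (reg_one (ctx hn)).add (hy.mul (ctx hn) hY)
  have e := Y_eq x
  change gf (Lp false (Plx x)) = 1 + sy x * gf (Lp false (Plx x)) at e
  rw [← e] at h2
  obtain ⟨e1, e2⟩ := hY.unique h2
  obtain ⟨p1, p2⟩ := hY.nonneg (ctx hn)
  obtain ⟨q1, q2⟩ := hy.nonneg (ctx hn)
  have hU : U ≤ 2 := by
    have : a * U ≤ 1 / 2 * U := by gcongr; linarith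
    linarith
  refine ⟨U, r, hY, hU, ?_⟩
  have h3 : a * r ≤ 1 / 2 * r := by gcongr; linarith
  have h4 : U * b ≤ 2 * ti n ^ 2 := by gcongr
  linarith

/-- One bootstrapping step. -/
lemma boot (hn : 1 ≤ n) (ht : ti n ≤ 1 / 4) (x : Fin n) {q a b : ℝ} (hF : Bd n (sF n) (ti n) q)
    (hx : Bd n (sx x) a b) : Bd n (sx x) (14169 * ti n ^ 5 + 16 * ti n ^ 3 * a)
      (2 * rh n ^ 2 * q + 327048 * ti n ^ 7 + 2 * ti n ^ 2 * (12 * ti n ^ 2 * a + 8 * ti n * b)) := by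
  refine Bd.of_le hn (isReg_N hn _ _) (sx_le x) ?_
  have t0 := ti_pos hn
  have hab : 0 ≤ a ∧ 0 ≤ b := by
    obtain ⟨_, _, h, h1, h2⟩ := hx
    obtain ⟨h3, h4⟩ := h.nonneg (ctx hn)
    exact ⟨h3.trans h1, h4.trans h2⟩
  obtain ⟨a0, b0⟩ := hab
  have M1 := bd_M hn ht x
  have y1 := bd_y hn ht x
  have Y1 := bd_Y hn ht x
  have t2 : ti n ^ 3 ≤ ti n ^ 2 * (1 / 4) := by
    have := mul_le_mul_of_nonneg_left ht (by positivity : 0 ≤ ti n ^ 2)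
    calc ti n ^ 3 = ti n ^ 2 * ti n := by ring
      _ ≤ _ := this
  have Y2 : Bd n (sY x * sY x) 4 (16 * ti n ^ 2) := (Y1.mul hn Y1).mono (by norm_num) (by nlinarith)
  have Y3 : Bd n (sY x * (sY x * sY x)) 8 (48 * ti n ^ 2) := (Y1.mul hn Y2).mono (by norm_num) (by nlinarith)
  have yY : Bd n (sy x * (sY x * sY x)) (8 * ti n) (12 * ti n ^ 2) := (y1.mul hn Y2).mono (by nlinarith) (by nlinarith)
  have yyY : Bd n (sy x * (sy x * (sY x * sY x))) (16 * ti n ^ 2) (32 * ti n ^ 3) :=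
    (y1.mul hn yY).mono (by nlinarith) (by nlinarith)
  have MY : Bd n (sM x * (sY x * (sY x * sY x))) (672 * ti n ^ 2) (2448 * ti n ^ 3) :=
    (M1.mul hn Y3).mono (by nlinarith) (by
      have : ti n ^ 4 ≤ ti n ^ 3 * (1 / 4) := by
        have := mul_le_mul_of_nonneg_left ht (by positivity : 0 ≤ ti n ^ 3)
        calc ti n ^ 4 = ti n ^ 3 * ti n := by ring
          _ ≤ _ := this
      nlinarith)
  have MMY : Bd n (sM x * (sM x * (sY x * (sY x * sY x)))) (56448 * ti n ^ 4) (326592 * ti n ^ 5) :=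
    (M1.mul hn MY).mono (le_of_eq (by ring)) (le_of_eq (by ring))
  have X1 : Bd n (X ^ 1) (ti n ^ 2) 0 := bd_Xp hn 0
  have X2 : Bd n (X ^ 2) (ti n ^ 4) 0 := bd_Xp hn 1
  have X3 : Bd n (X ^ 3) (ti n ^ 6) 0 := bd_Xp hn 2
  have X2' : Bd n (X ^ 2) (rh n ^ 2) 0 := ((bd_X' hn).pow hn 1).mono (by norm_num) (by simp)
  have hF' : Bd n (X ^ 2 * sF n) (ti n ^ 5) (rh n ^ 2 * q) := (X2'.mul hn hF).mono (by
    have : rh n ^ 2 ≤ (ti n ^ 2) ^ 2 := pow_le_pow_left₀ (rh_pos hn).le (rh_le_ti hn) 2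
    calc rh n ^ 2 * ti n ≤ (ti n ^ 2) ^ 2 * ti n := by gcongr
      _ = _ := by ring) (by simp)
  have t6 : ti n ^ 6 ≤ ti n ^ 5 * (1 / 4) := by
    have := mul_le_mul_of_nonneg_left ht (by positivity : 0 ≤ ti n ^ 5)
    calc ti n ^ 6 = ti n ^ 5 * ti n := by ring
      _ ≤ _ := this
  have xx := X1.mul hn (hx.mul hn yY)
  have yy := X2.mul hn yyY
  have mm := X2.mul hn M1
  rw [sxb]
  refine (hF'.add (hF'.add (X3.add (mm.add (mm.add (yy.add (yy.add (yy.add (xx.add (xx.add (X1.mul hn MMY))))))))))).mono ?_ ?_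
  · have : 0 < ti n ^ 5 := by positivity
    ring_nf
    linarith
  · ring_nf
    exact le_rfl

lemma sx_bd0 (hn : 1 ≤ n) (ht : ti n ≤ 1 / 4) (x : Fin n) : Bd n (sx x) (84 * ti n ^ 2) (180 * ti n ^ 3) :=
  Bd.of_le hn (isReg_N hn _ _) (gf_mono (Np_lit_le_PM x)) (bd_M hn ht x)

lemma bd_F (hn : 1 ≤ n) : Bd n (sF n) (ti n) (ti n ^ 2) := by
  refine Bd.of_le hn (isReg_N hn _ _) (gf_mono (fun t h => ⟨h.1, trivial⟩ : Np true {ff n} ⊆ Np true Set.univ)) ?_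
  have := bd_A hn
  rw [gA] at this
  rwa [ti, div_pow, one_pow]

lemma sx_upper (hn : 1 ≤ n) (ht : ti n ≤ 1 / 4) (x : Fin n) {Q q U r : ℝ} (hF : Reg (gG n) (rh n) (sF n) Q q)
    (hx : Reg (gG n) (rh n) (sx x) U r) : r ≤ 2 * rh n ^ 2 * q + 500000 * ti n ^ 7 := by
  have t0 := ti_pos hn
  obtain ⟨Q', q', hF', b1, b2⟩ := bd_F hn
  obtain ⟨rfl, rfl⟩ := hF.unique hF'
  have hFq : Bd n (sF n) (ti n) q := ⟨_, _, hF, b1, le_rfl⟩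
  have t2 : ti n ^ 2 ≤ 1 / 16 := by nlinarith
  have t3 : ti n ^ 3 ≤ 1 / 64 := by nlinarith
  have h1 := boot hn ht x (bd_F hn) (sx_bd0 hn ht x)
  have hr : rh n ^ 2 ≤ ti n ^ 4 := by
    have := pow_le_pow_left₀ (rh_pos hn).le (rh_le_ti hn) 2
    calc _ ≤ _ := this
      _ = _ := by ring
  have p5 : 0 < ti n ^ 5 := by positivity
  have p6 : 0 < ti n ^ 6 := by positivity
  have p7 : 0 < ti n ^ 7 := by positivity
  have h2 : Bd n (sx x) (15600 * ti n ^ 5) (180 * ti n ^ 3) := by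
    obtain ⟨U1, r1, g1, g2, g3⟩ := h1
    obtain ⟨U2, r2, k1, k2, k3⟩ := sx_bd0 hn ht x
    obtain ⟨rfl, rfl⟩ := g1.unique k1
    exact ⟨_, _, g1, by nlinarith, k3⟩
  have h3 := boot hn ht x (bd_F hn) h2
  have h4 : Bd n (sx x) (15600 * ti n ^ 5) (100000 * ti n ^ 6) := by
    obtain ⟨U1, r1, g1, g2, g3⟩ := h3
    obtain ⟨U2, r2, k1, k2, k3⟩ := h2
    obtain ⟨rfl, rfl⟩ := g1.unique k1
    refine ⟨_, _, g1, k2, g3.trans ?_⟩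
    have e1 : 2 * rh n ^ 2 * ti n ^ 2 ≤ 2 * ti n ^ 4 * ti n ^ 2 := by gcongr
    have e2 : ti n ^ 6 * ti n ≤ ti n ^ 6 * (1 / 4) := by gcongr
    have e3 : ti n ^ 6 * ti n ^ 3 ≤ ti n ^ 6 * (1 / 64) := by gcongr
    nlinarith
  obtain ⟨U1, r1, g1, g2, g3⟩ := boot hn ht x hFq h4
  obtain ⟨rfl, rfl⟩ := g1.unique hx
  refine g3.trans ?_
  have e2 : ti n ^ 7 * ti n ^ 2 ≤ ti n ^ 7 * (1 / 16) := by gcongr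
  nlinarith

/-- Binary nodes with the leaf `x` and a child in `S`. -/
def pr (c : Bool) (x : Fin n) (S : Set (AT n)) : Set (AT n) :=
  (fun s => AT.node c [.leaf x true, s]) '' S ∪ (fun s => AT.node c [s, .leaf x true]) '' S

lemma gf_pr (c : Bool) (x : Fin n) (S : Set (AT n)) (hS : AT.leaf x true ∉ S) :
    gf (pr c x S) = X ^ 2 * gf S + X ^ 2 * gf S := by
  rw [pr, gf_union]
  · congr 1
    · refine gf_bij (fun s => AT.node c [.leaf x true, s]) 2 ?_ (fun a h => ⟨a, h, rfl⟩) ?_ (fun b h => h)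
      · intro s _; simp only [sz_at, size_node, sizeList_cons, sizeList_nil, size_leaf]; omega
      · intro a _ b _ h; simpa using h
    · refine gf_bij (fun s => AT.node c [s, .leaf x true]) 2 ?_ (fun a h => ⟨a, h, rfl⟩) ?_ (fun b h => h)
      · intro s _; simp only [sz_at, size_node, sizeList_cons, sizeList_nil, size_leaf]
      · intro a _ b _ h; simpa using h
  · rw [Set.disjoint_left]
    rintro _ ⟨s, hs, rfl⟩ ⟨s', hs', h⟩
    simp at h
    rw [h.1] at hs'
    exact hS hs'

lemma leaf_notin_Np (x : Fin n) (b c) (P : Set (BF n)) : AT.leaf x b ∉ Np c P := by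
  rintro ⟨h, _⟩
  obtain ⟨ts, _, h⟩ := mem_N0.1 h
  simp at h

lemma pair_T0 (c : Bool) {s t : AT n} (hs : s ∈ K0 n c) (ht : t ∈ K0 n c) : [s, t] ∈ T0 n c := by
  rw [mem_T0]
  exact ⟨hs, mem_L0_cons.2 ⟨ht, nil_L0⟩, by simp⟩

lemma pr_sub (x : Fin n) : pr false x (Np true {ff n}) ⊆ Np false {lit x} := by
  have hv : AT.leaf x true ∈ K0 n false := mem_K0.2 (Or.inl (mem_V0.2 ⟨x, true, rfl⟩))
  rintro _ (⟨s, ⟨h1, h2⟩, rfl⟩ | ⟨s, ⟨h1, h2⟩, rfl⟩)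
  all_goals
    have hs : s ∈ K0 n false := mem_K0.2 (Or.inr h1)
    rw [Set.mem_singleton_iff] at h2
    refine ⟨mem_N0.2 ⟨_, pair_T0 _ (by assumption) (by assumption), rfl⟩, ?_⟩
    rw [Set.mem_singleton_iff]
    funext y
    simp [AT.eval, AT.evalList, h2, ff, lit]

/-- Lower bound for the trees computing a literal. -/
lemma sx_lower (hn : 1 ≤ n) (x : Fin n) {Q q U r : ℝ} (hF : Reg (gG n) (rh n) (sF n) Q q)
    (hx : Reg (gG n) (rh n) (sx x) U r) : 2 * rh n ^ 2 * q ≤ r := by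
  have hle := gf_mono (pr_sub x)
  rw [gf_pr _ _ _ (leaf_notin_Np _ _ _ _), sx_dual] at hle
  have hX := (reg_X (ctx hn)).mul (ctx hn) (reg_X (ctx hn))
  rw [← pow_two] at hX
  have h1 := hX.mul (ctx hn) hF
  have := ((h1.add h1).le (ctx hn) hx hle).2
  nlinarith

end S17

namespace S17
open PowerSeries Filter Topology
open CC AT

variable {n : ℕ}

def flip' (n : ℕ) : (Fin n × Bool) ↪ (Fin n × Bool) :=
  ⟨fun p => (p.1, !p.2), fun p q h => by
    simp only [Prod.mk.injEq, Bool.not_inj_iff] at h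
    exact Prod.ext h.1 h.2⟩

open Classical in
/-- Pairs of words of literals: the first injective, the second one hitting a negation of it. -/
noncomputable def DD (n K : ℕ) : Finset (Σ _ : Fin K ↪ (Fin n × Bool), (Fin K → Fin n × Bool)) :=
  Finset.univ.sigma fun u => (Fintype.piFinset fun _ => (Finset.univ.map (u.trans (flip' n)))ᶜ)ᶜ

lemma card_DD (n K : ℕ) : (DD n K).card = (2 * n).descFactorial K * ((2 * n) ^ K - (2 * n - K) ^ K) := by
  classical
  rw [DD, Finset.card_sigma, Finset.sum_congr rfl (g := fun _ => (2 * n) ^ K - (2 * n - K) ^ K)]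
  · rw [Finset.sum_const, smul_eq_mul, Finset.card_univ, Fintype.card_embedding_eq]
    simp [mul_comm n 2]
  · intro u _
    rw [Finset.card_compl, Fintype.card_piFinset_const, Finset.card_compl, Finset.card_map]
    simp [mul_comm n 2]

lemma card_DD_ge {n K : ℕ} (h1 : (1 : ℝ) / 16 ≤ K ^ 2 / (2 * n)) (h2 : (K : ℝ) ^ 2 / (2 * n) ≤ 1 / 4) (hn : 1 ≤ n) :
    3 / 68 * (2 * n : ℝ) ^ (2 * K) ≤ (DD n K).card := by
  set N : ℕ := 2 * n with hN
  have hNr : (N : ℝ) = 2 * n := by rw [hN]; push_cast; rfl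
  rw [← hNr] at h1 h2 ⊢
  have N0 : (0 : ℝ) < N := by rw [hNr]; positivity
  have hKN : K ≤ N := by
    rw [div_le_iff₀ N0] at h2
    have : (K : ℝ) ^ 2 ≤ (N : ℝ) := by linarith
    have : K ^ 2 ≤ N := by exact_mod_cast this
    nlinarith
  have hx0 : (0 : ℝ) ≤ K / N := by positivity
  have hx1 : (K : ℝ) / N ≤ 1 := by rw [div_le_one N0]; exact_mod_cast hKN
  have e : (((N - K : ℕ) : ℝ)) = N * (1 - K / N) := by
    rw [Nat.cast_sub hKN]; field_simp
  have k2 : (K : ℝ) * (K / N) = K ^ 2 / N := by ring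
  have b1 : 1 - (K : ℝ) ^ 2 / N ≤ (1 - K / N) ^ K := by
    have := one_add_mul_le_pow (a := -((K : ℝ) / N)) (by linarith) K
    rw [← k2]
    calc _ = 1 + (K : ℝ) * (-(K / N)) := by ring
      _ ≤ _ := this
      _ = _ := by ring
  have b2 : 1 + (K : ℝ) ^ 2 / N ≤ (1 + K / N) ^ K := by
    have := one_add_mul_le_pow (a := ((K : ℝ) / N)) (by linarith) K
    rwa [k2] at this
  have b3 : (1 - (K : ℝ) / N) ^ K * (1 + K / N) ^ K ≤ 1 := by
    rw [← mul_pow]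
    apply pow_le_one₀ <;> nlinarith
  have p0 : 0 ≤ (1 - (K : ℝ) / N) ^ K := pow_nonneg (by linarith) _
  have b4 : (1 - (K : ℝ) / N) ^ K ≤ 16 / 17 := by
    have : (1 - (K : ℝ) / N) ^ K * (17 / 16) ≤ (1 - (K : ℝ) / N) ^ K * (1 + K / N) ^ K := by
      gcongr; linarith
    linarith
  have c1 : (N : ℝ) ^ K * (3 / 4) ≤ N.descFactorial K := by
    have h : (N - K) ^ K ≤ N.descFactorial K :=
      (Nat.pow_le_pow_left (by omega) _).trans (Nat.pow_sub_le_descFactorial N K)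
    have h' : (((N - K : ℕ) : ℝ)) ^ K ≤ N.descFactorial K := by exact_mod_cast h
    refine le_trans ?_ h'
    rw [e, mul_pow]
    gcongr
    linarith
  have c2 : (N : ℝ) ^ K * (1 / 17) ≤ ((N ^ K - (N - K) ^ K : ℕ) : ℝ) := by
    rw [Nat.cast_sub (Nat.pow_le_pow_left (by omega) _), Nat.cast_pow, Nat.cast_pow, e, mul_pow]
    have : 0 < (N : ℝ) ^ K := by positivity
    nlinarith
  have hcard : ((DD n K).card : ℝ) = (N.descFactorial K : ℝ) * ((N ^ K - (N - K) ^ K : ℕ) : ℝ) := by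
    rw [card_DD, ← hN]; exact Nat.cast_mul _ _
  rw [hcard]
  calc 3 / 68 * (N : ℝ) ^ (2 * K) = ((N : ℝ) ^ K * (3 / 4)) * ((N : ℝ) ^ K * (1 / 17)) := by rw [two_mul, pow_add]; ring
    _ ≤ _ := by gcongr

def lf (p : Fin n × Bool) : AT n := .leaf p.1 p.2

lemma lf_inj : Function.Injective (lf (n := n)) := by
  rintro ⟨a, b⟩ ⟨c, d⟩ h; simpa [lf] using h

lemma sizeList_ofFn {K : ℕ} (u : Fin K → Fin n × Bool) : sizeList (List.ofFn fun i => lf (u i)) = K := by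
  induction K with
  | zero => simp [sizeList_nil]
  | succ K ih => rw [List.ofFn_succ, sizeList_cons, ih, lf, size_leaf]; omega

lemma ofFn_L0 {K : ℕ} (c) (u : Fin K → Fin n × Bool) : (List.ofFn fun i => lf (u i)) ∈ L0 n c := by
  intro t ht
  rw [List.mem_ofFn] at ht
  obtain ⟨i, rfl⟩ := ht
  exact mem_K0.2 (Or.inl (mem_V0.2 ⟨_, _, rfl⟩))

/-- The tree built from two words of literals and a forest. -/
def bt {K : ℕ} (d : Σ _ : Fin K ↪ (Fin n × Bool), (Fin K → Fin n × Bool)) (l : List (AT n)) : AT n :=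
  .node false ((List.ofFn fun i => lf (d.1 i)) ++ ((List.ofFn fun i => lf (d.2 i)) ++ l))

lemma bt_inj {K : ℕ} {d d' : Σ _ : Fin K ↪ (Fin n × Bool), (Fin K → Fin n × Bool)} {l l' : List (AT n)}
    (h : bt d l = bt d' l') : d = d' ∧ l = l' := by
  rw [bt, bt, AT.node.injEq] at h
  obtain ⟨h1, h2⟩ := List.append_inj h.2 (by simp)
  obtain ⟨h2, h3⟩ := List.append_inj h2 (by simp)
  rw [List.ofFn_inj] at h1 h2
  refine ⟨?_, h3⟩
  obtain ⟨u, v⟩ := d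
  obtain ⟨u', v'⟩ := d'
  have e1 : u = u' := by ext1 i; exact lf_inj (congrFun h1 i)
  have e2 : v = v' := by ext1 i; exact lf_inj (congrFun h2 i)
  rw [e1, e2]

lemma bt_mem {K : ℕ} (hK : 1 ≤ K) {d : Σ _ : Fin K ↪ (Fin n × Bool), (Fin K → Fin n × Bool)} (hd : d ∈ DD n K)
    {l : List (AT n)} (hl : l ∈ L0 n false) : bt d l ∈ Np false {tt n} := by
  classical
  obtain ⟨u, v⟩ := d
  refine ⟨mem_N0.2 ⟨_, ⟨mem_L0_append.2 ⟨ofFn_L0 _ _, mem_L0_append.2 ⟨ofFn_L0 _ _, hl⟩⟩, ?_⟩, rfl⟩, ?_⟩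
  · simp; omega
  · simp only [DD, Finset.mem_sigma, Finset.mem_univ, true_and, Finset.mem_compl, Fintype.mem_piFinset, not_forall,
      not_not, Finset.mem_map] at hd
    obtain ⟨j, i, hij⟩ := hd
    rw [Set.mem_singleton_iff]
    funext y
    rw [bt, eval_node, tt, evalList_false]
    have hu : lf (u i) ∈ List.ofFn fun i => lf (u i) := List.mem_ofFn.2 ⟨i, rfl⟩
    have hv : lf (v j) ∈ List.ofFn fun i => lf (v i) := List.mem_ofFn.2 ⟨j, rfl⟩
    by_cases h : eval (lf (u i)) y = true
    · exact ⟨_, List.mem_append_left _ hu, h⟩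
    · refine ⟨_, List.mem_append_right _ (List.mem_append_left _ hv), ?_⟩
      have hij' : v j = ((u i).1, !(u i).2) := hij.symm
      rw [hij']
      simp only [lf, eval_leaf] at h ⊢
      revert h
      cases (u i).2 <;> simp

lemma sT_ge {K : ℕ} (hK : 1 ≤ K) : Le (∑ _d ∈ DD n K, X ^ (2 * K + 1) * gG n) (gf (Np false {tt n})) := by
  classical
  have e : ∀ d ∈ DD n K, X ^ (2 * K + 1) * gG n = gf ((fun l => bt d l) '' L0 n false) := by
    intro d _
    rw [← gf_L0 false]
    symm
    refine gf_bij (fun l => bt d l) (2 * K + 1) ?_ (fun a h => ⟨a, h, rfl⟩) ?_ (fun b h => h)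
    · intro l _
      simp only [sz_at, sz_list, bt, size_node, sizeList_append, sizeList_ofFn]; omega
    · intro a _ b _ h; exact (bt_inj h).2
  rw [Finset.sum_congr rfl e, ← gf_biUnion]
  · apply gf_mono
    intro t ht
    simp only [Set.mem_iUnion] at ht
    obtain ⟨d, hd, l, hl, rfl⟩ := ht
    exact bt_mem hK hd hl
  · intro d _ d' _ hne
    rw [Set.disjoint_left]
    rintro _ ⟨l, _, rfl⟩ ⟨l', _, h⟩
    exact hne (bt_inj h).1.symm

lemma sF_dual : gf (Np false {tt n}) = sF n := by
  have := gf_dual true {tt n}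
  rw [Bool.not_true] at this
  rw [this, sF]
  congr 2
  ext f
  have h1 : df (tt n) = ff n := by funext y; simp [df, tt, ff]
  have h2 : df (ff n) = tt n := by funext y; simp [df, tt, ff]
  simp only [Set.mem_preimage, Set.mem_singleton_iff]
  constructor
  · intro h; rw [← df_df f, h, h1]
  · rintro rfl; exact h2

noncomputable def c0 : ℝ := 3 / 68 * Real.exp (-2)
lemma c0_pos : 0 < c0 := by unfold c0; positivity

lemma q_ge (hn : 1 ≤ n) (ht : ti n ≤ 1 / 4) {Q q : ℝ} (hF : Reg (gG n) (rh n) (sF n) Q q) : c0 * rh n ≤ q := by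
  have w1 := wv_gt hn
  have w4 : 4 ≤ wv n := by
    rw [ti, div_le_div_iff₀ (by linarith) (by norm_num)] at ht; linarith
  obtain ⟨K, hK⟩ : ∃ K : ℕ, K = ⌊wv n / 2⌋₊ := ⟨_, rfl⟩
  have k1 : (K : ℝ) ≤ wv n / 2 := by rw [hK]; exact Nat.floor_le (by linarith)
  have k2 : wv n / 4 ≤ K := by
    have := Nat.lt_floor_add_one (wv n / 2)
    rw [← hK] at this
    linarith
  have hK1 : 1 ≤ K := by
    have : (1 : ℝ) ≤ K := by linarith
    exact_mod_cast this
  have n0 : (0 : ℝ) < 2 * n := by positivity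
  have hc := card_DD_ge (n := n) (K := K) (by
    rw [le_div_iff₀ n0, ← wv_sq]; nlinarith) (by
    rw [div_le_iff₀ n0, ← wv_sq]; nlinarith) hn
  have hX := (reg_X (ctx hn))
  have hXp : ∀ k : ℕ, Reg (gG n) (rh n) (X ^ k) (rh n ^ k) 0 := by
    intro k
    induction k with
    | zero => simpa using reg_one (ctx hn)
    | succ k ih => rw [pow_succ, pow_succ]; exact (ih.mul (ctx hn) hX).congr rfl (by ring)
  have h1 := Reg.sum (ctx hn) (DD n K) (fun _ _ => (hXp (2 * K + 1)).mul (ctx hn) (ctx hn).reg)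
  have h2 := (h1.le (ctx hn) hF (by rw [← sF_dual]; exact sT_ge hK1)).2
  simp only [mul_one, mul_zero, add_zero, Finset.sum_const, nsmul_eq_mul] at h2
  refine le_trans ?_ h2
  have r0 := rh_pos hn
  have e1 : Real.exp (-2) ≤ ((2 * n : ℝ) * rh n) ^ (2 * K) := by
    have : (2 * n : ℝ) * rh n = (1 + 2 / wv n)⁻¹ := by
      rw [← wv_sq, rh]; field_simp
    rw [this, inv_pow, Real.exp_neg]
    apply inv_anti₀ (by positivity)
    have : 1 + 2 / wv n ≤ Real.exp (2 / wv n) := by rw [add_comm]; exact Real.add_one_le_exp _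
    calc (1 + 2 / wv n) ^ (2 * K) ≤ (Real.exp (2 / wv n)) ^ (2 * K) := by gcongr
      _ = Real.exp ((2 * K : ℕ) * (2 / wv n)) := by rw [← Real.exp_nat_mul]
      _ ≤ Real.exp 2 := by
        apply Real.exp_le_exp.2
        push_cast
        rw [mul_div_assoc', div_le_iff₀ (by linarith)]
        linarith
  calc c0 * rh n = 3 / 68 * Real.exp (-2) * rh n := rfl
    _ ≤ 3 / 68 * ((2 * n : ℝ) * rh n) ^ (2 * K) * rh n := by gcongr
    _ = (3 / 68 * (2 * n : ℝ) ^ (2 * K)) * rh n ^ (2 * K + 1) := by rw [mul_pow, pow_succ]; ring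
    _ ≤ _ := by gcongr

/-- Conjunctions that are tautologies are rare. -/
lemma bd_TT (hn : 1 ≤ n) : Bd n (gf (Np true {tt n})) (6 * ti n ^ 3) (6 * ti n ^ 4) := by
  have hsub : Np true {tt n} ⊆ (fun a : AT n × AT n × List (AT n) => AT.node true (a.1 :: a.2.1 :: a.2.2)) ''
      (N0 n false ×ˢ (N0 n false ×ˢ L0 n true)) := by
    rintro t ⟨h1, h2⟩
    obtain ⟨ts, hts, rfl⟩ := mem_N0.1 h1
    rw [eval_node, Set.mem_singleton_iff] at h2
    have key : ∀ s ∈ ts, s ∈ N0 n false := by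
      intro s hs
      have ev : ∀ y, eval s y = true := fun y => by
        have : evalList true ts y = true := by rw [h2]; rfl
        exact (evalList_true _ _).1 this s hs
      rcases mem_K0.1 (hts.1 s hs) with h | h
      · obtain ⟨i, b, rfl⟩ := mem_V0.1 h
        have := ev (fun _ => !b)
        cases b <;> simp [AT.eval] at this
      · exact h
    obtain ⟨hL, hlen⟩ := hts
    rcases ts with _ | ⟨a, _ | ⟨b, l⟩⟩
    · simp at hlen
    · simp at hlen
    · rw [mem_L0_cons, mem_L0_cons] at hL
      exact ⟨(a, b, l), ⟨key a (by simp), key b (by simp), hL.2.2⟩, rfl⟩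
  have hle : Le (gf (Np true {tt n})) (X ^ 1 * (gA n * (gA n * gG n))) := by
    refine (gf_mono hsub).trans (gf_img ?_ ?_)
    · rintro ⟨a, b, c⟩ -
      simp only [sz_at, sz_prod, sz_list, size_node, sizeList_cons]
    · simp only [gf_prod, gf_N0, gf_L0]
  refine Bd.of_le hn (isReg_N hn _ _) hle ?_
  have t0 := ti_pos hn
  have hwt : wv n = 1 / ti n := by rw [ti, one_div_one_div]
  have G1 : Bd n (gG n) (2 / ti n) 1 := by
    have := bd_G hn; rw [hwt] at this; simpa [div_eq_mul_inv] using this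
  have A1 : Bd n (gA n) (ti n) (ti n ^ 2) := by
    have := bd_A hn; rw [hwt] at this; simpa [div_eq_mul_inv] using this
  refine ((bd_Xp hn 0).mul hn (A1.mul hn (A1.mul hn G1))).mono ?_ ?_
  · generalize ti n = t at *
    have : 0 < t ^ 3 := by positivity
    field_simp
    ring_nf
    nlinarith
  · generalize ti n = t at *
    have : 0 < t ^ 3 := by positivity
    field_simp
    ring_nf
    nlinarith

end S17

namespace S17
open PowerSeries Filter Topology
open CC AT

variable {n : ℕ}

lemma coeff_count (S : Set (AT n)) (m : ℕ) : coeff m (gf {t | t ∈ S ∧ WF t}) = (countIn n S m : ℝ) := by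
  rw [coeff_gf, countIn, ← Nat.card_coe_set_eq]
  congr 1
  refine Nat.card_congr (Equiv.subtypeEquivRight fun t => ?_)
  simp only [Set.mem_ofPred_eq, sz_at, and_assoc]

lemma reg_Vp (hn : 1 ≤ n) (P : Set (BF n)) : ∃ U, Reg (gG n) (rh n) (gf (Vp P)) U 0 := by
  obtain ⟨U, r, h⟩ := isReg_K hn true P
  obtain ⟨U', r', h'⟩ := isReg_N hn (!true) P
  rw [gf_Kp] at h
  have h1 := h.sub h' (nn_gf _)
  have h2 := (h1.le (ctx hn) (reg_V hn) (gf_mono fun t h => h.1)).2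
  exact ⟨_, h1.congr rfl (le_antisymm h2 (h1.nonneg (ctx hn)).2)⟩

lemma gf_all (P : Set (BF n)) : gf {t | t ∈ {t : AT n | eval t ∈ P} ∧ WF t} =
    gf (Vp P) + gf (Np true P) + gf (Np false P) := by
  have e : {t | t ∈ {t : AT n | eval t ∈ P} ∧ WF t} = Vp P ∪ Np true P ∪ Np false P := by
    ext t
    constructor
    · rintro ⟨h1, h2⟩
      cases t with
      | leaf i b => exact Or.inl (Or.inl ⟨rfl, h1⟩)
      | node c ts =>
        cases c
        · exact Or.inr ⟨⟨h2, rfl⟩, h1⟩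
        · exact Or.inl (Or.inr ⟨⟨h2, rfl⟩, h1⟩)
    · rintro ((h | h) | h)
      · refine ⟨h.2, ?_⟩
        obtain ⟨i, b, rfl⟩ := mem_V0.1 h.1
        exact WF.leaf _ _
      · exact ⟨h.2, h.1.1⟩
      · exact ⟨h.2, h.1.1⟩
  rw [e, gf_union, gf_union]
  · rw [Set.disjoint_left]
    rintro t h h'
    have h1 := h.1
    have h2 := h'.1.2
    rw [V0, Set.mem_ofPred_eq] at h1
    rw [h1] at h2; simp at h2
  · rw [Set.disjoint_left]
    rintro t h h'
    have h2 := h'.1.2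
    rcases h with h | h
    · have h1 := h.1
      rw [V0, Set.mem_ofPred_eq] at h1
      rw [h1] at h2; simp at h2
    · have h1 := h.1.2
      rw [h1] at h2; simp at h2

lemma reg_all (hn : 1 ≤ n) (P : Set (BF n)) {U r U' r' : ℝ} (h : Reg (gG n) (rh n) (gf (Np true P)) U r)
    (h' : Reg (gG n) (rh n) (gf (Np false P)) U' r') :
    ∃ W, Reg (gG n) (rh n) (gf {t | t ∈ {t : AT n | eval t ∈ P} ∧ WF t}) W (r + r') := by
  obtain ⟨W, hW⟩ := reg_Vp hn P
  rw [gf_all]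
  exact ⟨_, ((hW.add h).add h').congr rfl (by ring)⟩

noncomputable def RR (n : ℕ) : ℝ := rh n / (1 + rh n) + rh n / (1 + rh n)

lemma RR_pos (hn : 1 ≤ n) : 0 < RR n := by
  have := rh_pos hn
  unfold RR; positivity

lemma lim_ratio (hn : 1 ≤ n) (S : Set (AT n)) {U r : ℝ} (h : Reg (gG n) (rh n) (gf {t | t ∈ S ∧ WF t}) U r) :
    Tendsto (fun m => (countIn n S m : ℝ) / (A n m : ℝ)) atTop (𝓝 (r / RR n)) := by
  have hA := reg_A hn
  have hA' := hA
  rw [gA, ← gf_Np_univ false] at hA'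
  obtain ⟨W, hW⟩ := reg_all hn Set.univ hA hA'
  refine (h.lim.div hW.lim (RR_pos hn).ne').congr fun m => ?_
  have e : {t : AT n | eval t ∈ (Set.univ : Set (BF n))} = Set.univ := by ext; simp
  rw [e, Pi.div_apply, coeff_count, coeff_count, div_div_div_cancel_right₀ ((ctx hn).pos m).ne', A]

lemma simple_eq (x : Fin n) : {t | t ∈ SimpleX n x ∧ WF t} = pr false x (Np true {ff n}) ∪ pr true x (Np false {tt n}) := by
  have hv : ∀ c, AT.leaf x true ∈ K0 n c := fun c => mem_K0.2 (Or.inl (mem_V0.2 ⟨x, true, rfl⟩))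
  have child : ∀ c (ts : List (AT n)) s, WF (.node c ts) → s ∈ ts → isLeafB s = false → s ∈ N0 n (!c) := by
    intro c ts s h1 h2 h3
    rcases mem_K0.1 ((wf_node.1 h1).1 s h2) with h | h
    · obtain ⟨i, b, rfl⟩ := mem_V0.1 h
      simp [isLeafB] at h3
    · exact h
  have nl : ∀ c (s : AT n), s ∈ N0 n c → isLeafB s = false := by
    intro c s h
    obtain ⟨ts, _, rfl⟩ := mem_N0.1 h
    rfl
  ext t
  constructor
  · rintro ⟨⟨s, h1, (⟨h2, rfl | rfl⟩ | ⟨h2, rfl | rfl⟩)⟩, h3⟩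
    · exact Or.inl (Or.inl ⟨s, ⟨child _ _ s h3 (by simp) h1, h2⟩, rfl⟩)
    · exact Or.inl (Or.inr ⟨s, ⟨child _ _ s h3 (by simp) h1, h2⟩, rfl⟩)
    · exact Or.inr (Or.inl ⟨s, ⟨child _ _ s h3 (by simp) h1, h2⟩, rfl⟩)
    · exact Or.inr (Or.inr ⟨s, ⟨child _ _ s h3 (by simp) h1, h2⟩, rfl⟩)
  · rintro ((⟨s, h, rfl⟩ | ⟨s, h, rfl⟩) | (⟨s, h, rfl⟩ | ⟨s, h, rfl⟩))
    · exact ⟨⟨s, nl _ _ h.1, Or.inl ⟨h.2, Or.inl rfl⟩⟩, wf_node.2 (pair_T0 _ (hv _) (mem_K0.2 (Or.inr h.1)))⟩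
    · exact ⟨⟨s, nl _ _ h.1, Or.inl ⟨h.2, Or.inr rfl⟩⟩, wf_node.2 (pair_T0 _ (mem_K0.2 (Or.inr h.1)) (hv _))⟩
    · exact ⟨⟨s, nl _ _ h.1, Or.inr ⟨h.2, Or.inl rfl⟩⟩, wf_node.2 (pair_T0 _ (hv _) (mem_K0.2 (Or.inr h.1)))⟩
    · exact ⟨⟨s, nl _ _ h.1, Or.inr ⟨h.2, Or.inr rfl⟩⟩, wf_node.2 (pair_T0 _ (mem_K0.2 (Or.inr h.1)) (hv _))⟩

lemma reg_simple (hn : 1 ≤ n) (x : Fin n) {Q q : ℝ} (hF : Reg (gG n) (rh n) (sF n) Q q) :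
    ∃ W, Reg (gG n) (rh n) (gf {t | t ∈ SimpleX n x ∧ WF t}) W (4 * rh n ^ 2 * q) := by
  rw [simple_eq, gf_union]
  · rw [gf_pr _ _ _ (leaf_notin_Np _ _ _ _), gf_pr _ _ _ (leaf_notin_Np _ _ _ _), sF_dual]
    have hX := (reg_X (ctx hn)).mul (ctx hn) (reg_X (ctx hn))
    rw [← pow_two] at hX
    have h1 := hX.mul (ctx hn) hF
    exact ⟨_, ((h1.add h1).add (h1.add h1)).congr rfl (by ring)⟩
  · rw [Set.disjoint_left]
    rintro _ (⟨s, h, rfl⟩ | ⟨s, h, rfl⟩) (⟨s', h', e⟩ | ⟨s', h', e⟩) <;> simp at e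

lemma main_n (n : ℕ) : ∃ q q' r : ℝ, ∀ h : 1 ≤ n,
    HasLimRatio n (SimpleX n ⟨0, h⟩) (4 * rh n ^ 2 * q / RR n) ∧
    Tendsto (fun m => Pmn n m (fun x => x ⟨0, h⟩)) atTop (𝓝 ((r + r) / RR n)) ∧
    Tendsto (fun m => Pmn n m (fun _ => true)) atTop (𝓝 ((q' + q) / RR n)) ∧
    0 ≤ q' ∧ q' ≤ 6 * ti n ^ 4 ∧ 2 * rh n ^ 2 * q ≤ r ∧
    (ti n ≤ 1 / 4 → c0 * rh n ≤ q ∧ r ≤ 2 * rh n ^ 2 * q + 500000 * ti n ^ 7) := by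
  by_cases hn : 1 ≤ n
  swap
  · exact ⟨0, 0, 0, fun h => absurd h hn⟩
  obtain ⟨Q, q, hF⟩ := isReg_N hn true {ff n}
  change Reg _ _ (sF n) _ _ at hF
  obtain ⟨Q', q', hT, _, hq'⟩ := bd_TT hn
  obtain ⟨U, r, hx⟩ := isReg_N hn true {lit (⟨0, hn⟩ : Fin n)}
  refine ⟨q, q', r, fun _ => ⟨?_, ?_, ?_, (hT.nonneg (ctx hn)).2, hq', sx_lower hn _ hF hx, fun ht =>
    ⟨q_ge hn ht hF, sx_upper hn ht _ hF hx⟩⟩⟩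
  · obtain ⟨W, hW⟩ := reg_simple hn ⟨0, hn⟩ hF
    exact lim_ratio hn _ hW
  · have hx' := hx
    change Reg _ _ (sx _) _ _ at hx'
    rw [← sx_dual] at hx'
    obtain ⟨W, hW⟩ := reg_all hn _ hx hx'
    exact lim_ratio hn _ hW
  · have hF' := hF
    rw [← sF_dual] at hF'
    obtain ⟨W, hW⟩ := reg_all hn _ hT hF'
    exact lim_ratio hn _ hW

lemma tendsto_ti : Tendsto ti atTop (𝓝 0) := by
  have h : Tendsto wv atTop atTop :=
    Real.tendsto_sqrt_atTop.comp (tendsto_natCast_atTop_atTop.const_mul_atTop (by norm_num : (0 : ℝ) < 2))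
  exact (tendsto_inv_atTop_zero.comp h).congr fun n => by simp [ti]

lemma rh_ge (hn : 1 ≤ n) (ht : ti n ≤ 1 / 4) : ti n ^ 2 / 2 ≤ rh n := by
  have w1 := wv_gt hn
  have w4 : 4 ≤ wv n := by
    rw [ti, div_le_div_iff₀ (by linarith) (by norm_num)] at ht; linarith
  rw [ti, rh, div_pow, one_pow, div_div]
  apply one_div_le_one_div_of_le (by positivity)
  nlinarith

lemma n_rh (hn : 1 ≤ n) : 2 * n * rh n = 1 / (1 + 2 * ti n) := by
  have w1 := wv_gt hn
  rw [← wv_sq, rh, ti]; field_simp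

open Filter in
/-- For the literal `x = x₁` and the literal function `f = (x₁,…,x_n) ↦ x₁`,
`P_n(f) ∼ μ_n(𝒳)` as `n → ∞`, and consequently `P_n(f) ∼ P_n(True)/n²`. -/
theorem main17 :
    ∃ μ p q : ℕ → ℝ,
      (∀ n : ℕ, ∀ h : 1 ≤ n,
        HasLimRatio n (SimpleX n ⟨0, h⟩) (μ n) ∧
        Tendsto (fun m => Pmn n m (fun x => x ⟨0, h⟩)) atTop (nhds (p n)) ∧
        Tendsto (fun m => Pmn n m (fun _ => true)) atTop (nhds (q n))) ∧
      Tendsto (fun n : ℕ => p n / μ n) atTop (nhds 1) ∧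
      Tendsto (fun n : ℕ => (n : ℝ) ^ 2 * p n / q n) atTop (nhds 1) := by
  choose q q' r H using main_n
  have hev : ∀ᶠ n : ℕ in atTop, 1 ≤ n ∧ ti n ≤ 1 / 4 :=
    (eventually_ge_atTop 1).and (tendsto_ti.eventually_le_const (by norm_num))
  have c0p := c0_pos
  have main : Tendsto (fun n => r n / (2 * rh n ^ 2 * q n)) atTop (𝓝 1) := by
    have up : Tendsto (fun n => 1 + 2000000 / c0 * ti n) atTop (𝓝 1) := by
      simpa using (tendsto_ti.const_mul (2000000 / c0)).const_add 1
    refine tendsto_of_tendsto_of_tendsto_of_le_of_le' tendsto_const_nhds up ?_ ?_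
    · filter_upwards [hev] with n ⟨hn, ht⟩
      obtain ⟨_, _, _, _, _, h1, h2⟩ := H n hn
      obtain ⟨h2, h3⟩ := h2 ht
      have r0 := rh_pos hn
      have q0 : 0 < q n := lt_of_lt_of_le (by positivity) h2
      rwa [one_le_div (by positivity)]
    · filter_upwards [hev] with n ⟨hn, ht⟩
      obtain ⟨_, _, _, _, _, h1, h2⟩ := H n hn
      obtain ⟨h2, h3⟩ := h2 ht
      have r0 := rh_pos hn
      have t0 := ti_pos hn
      have q0 : 0 < q n := lt_of_lt_of_le (by positivity) h2
      rw [div_le_iff₀ (by positivity)]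
      refine h3.trans ?_
      have h4 := rh_ge hn ht
      have : 2 * (ti n ^ 2 / 2) ^ 2 * (c0 * (ti n ^ 2 / 2)) ≤ 2 * rh n ^ 2 * q n := by
        refine mul_le_mul (by gcongr) (le_trans (by gcongr) h2) (by positivity) (by positivity)
      have h5 : 2000000 / c0 * ti n * (2 * (ti n ^ 2 / 2) ^ 2 * (c0 * (ti n ^ 2 / 2))) = 500000 * ti n ^ 7 := by
        field_simp; ring
      have h6 : 2000000 / c0 * ti n * (2 * (ti n ^ 2 / 2) ^ 2 * (c0 * (ti n ^ 2 / 2))) ≤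
        2000000 / c0 * ti n * (2 * rh n ^ 2 * q n) := by gcongr
      linarith
  have aux : Tendsto (fun n => q' n / q n) atTop (𝓝 0) := by
    have up : Tendsto (fun n => 12 / c0 * ti n ^ 2) atTop (𝓝 0) := by
      simpa using (tendsto_ti.pow 2).const_mul (12 / c0)
    refine tendsto_of_tendsto_of_tendsto_of_le_of_le' tendsto_const_nhds up ?_ ?_
    · filter_upwards [hev] with n ⟨hn, ht⟩
      obtain ⟨_, _, _, h0, _, h1, h2⟩ := H n hn
      have r0 := rh_pos hn
      have q0 : 0 < q n := lt_of_lt_of_le (by positivity) (h2 ht).1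
      positivity
    · filter_upwards [hev] with n ⟨hn, ht⟩
      obtain ⟨_, _, _, h0, h5, h1, h2⟩ := H n hn
      obtain ⟨h2, h3⟩ := h2 ht
      have r0 := rh_pos hn
      have t0 := ti_pos hn
      have q0 : 0 < q n := lt_of_lt_of_le (by positivity) h2
      have h4 := rh_ge hn ht
      rw [div_le_iff₀ q0]
      have : c0 * (ti n ^ 2 / 2) ≤ q n := le_trans (by gcongr) h2
      calc q' n ≤ 6 * ti n ^ 4 := h5
        _ = 12 / c0 * ti n ^ 2 * (c0 * (ti n ^ 2 / 2)) := by field_simp; ring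
        _ ≤ _ := by gcongr
  refine ⟨fun n => 4 * rh n ^ 2 * q n / RR n, fun n => (r n + r n) / RR n, fun n => (q' n + q n) / RR n,
    fun n h => ⟨(H n h).1, (H n h).2.1, (H n h).2.2.1⟩, ?_, ?_⟩
  · refine main.congr' ?_
    filter_upwards [hev] with n ⟨hn, ht⟩
    obtain ⟨_, _, _, h0, _, h1, h2⟩ := H n hn
    have r0 := rh_pos hn
    have R0 := RR_pos hn
    have q0 : 0 < q n := lt_of_lt_of_le (by positivity) (h2 ht).1
    field_simp
    ring
  · have l1 : Tendsto (fun n => (1 / (1 + 2 * ti n)) ^ 2) atTop (𝓝 1) := by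
      have : Tendsto (fun n => 1 + 2 * ti n) atTop (𝓝 1) := by
        simpa using (tendsto_ti.const_mul 2).const_add 1
      simpa using (this.inv₀ one_ne_zero).pow 2
    have l2 : Tendsto (fun n => (1 + q' n / q n)⁻¹) atTop (𝓝 1) := by
      have : Tendsto (fun n => 1 + q' n / q n) atTop (𝓝 1) := by
        simpa using aux.const_add 1
      simpa using this.inv₀ one_ne_zero
    have l3 := (main.mul l1).mul l2
    rw [mul_one, mul_one] at l3
    refine l3.congr' ?_
    filter_upwards [hev] with n ⟨hn, ht⟩
    obtain ⟨_, _, _, h0, _, h1, h2⟩ := H n hn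
    have r0 := rh_pos hn
    have R0 := RR_pos hn
    have q0 : 0 < q n := lt_of_lt_of_le (by positivity) (h2 ht).1
    have qq : 0 < q' n + q n := by linarith
    have qq' : 0 < q n + q' n := by linarith
    rw [← n_rh hn]
    field_simp
    ring

end S17

open Filter in
/-- For the literal `x = x₁` and the literal function `f = (x₁,…,x_n) ↦ x₁`,
`P_n(f) ∼ μ_n(𝒳)` as `n → ∞`, and consequently `P_n(f) ∼ P_n(True)/n²`. -/
theorem statement17 :
    ∃ μ p q : ℕ → ℝ,
      (∀ n : ℕ, ∀ h : 1 ≤ n,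
        HasLimRatio n (SimpleX n ⟨0, h⟩) (μ n) ∧
        Tendsto (fun m => Pmn n m (fun x => x ⟨0, h⟩)) atTop (nhds (p n)) ∧
        Tendsto (fun m => Pmn n m (fun _ => true)) atTop (nhds (q n))) ∧
      Tendsto (fun n : ℕ => p n / μ n) atTop (nhds 1) ∧
      Tendsto (fun n : ℕ => (n : ℝ) ^ 2 * p n / q n) atTop (nhds 1) := S17.main17
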